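/- Lemma 1. Under Assumptions 1–9 and with the estimated factor tensor F̂_{t−1} and the sign matrix Ĵ_r from Proposition 1, the following hold as m, T → ∞: (i) (1/T)·Σ_{t=1}^T (F̂_{t−1} − F_{t−1} ×₃ Ĵ_r) ×₁ X_tᵀ ×₂ y_{t−1}ᵀ, an (r+2N)×1×r tensor, is O_p(1/min(√m, √T)); (ii) (1/T)·Σ_{t=1}^T (F̂_{t−1} − F_{t−1} ×₃ Ĵ_r) ×₁ X̂_tᵀ ×₂ y_{t−1}ᵀ, an (r+2N)×1×r tensor, is O_p(1/min(√m, √T)); (iii) (1/T)·Σ_{t=1}^T (F̂_{t−1} − F_{t−1} ×₃ Ĵ_r) ×₁ ν_tᵀ ×₂ y_{t−1}ᵀ, a 1×1×r tensor, is O_p(1/min(√m, √T)). -/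

import Mathlib

open MeasureTheory Matrix ProbabilityTheory

/-- Frobenius norm of a real matrix. -/
noncomputable def frobNorm {a b : Type*} [Fintype a] [Fintype b]
    (A : Matrix a b ℝ) : ℝ :=
  Real.sqrt (∑ i, ∑ j, (A i j) ^ 2)

/-- Frobenius norm of an order-3 tensor. -/
noncomputable def frobT {a b c : Type*} [Fintype a] [Fintype b] [Fintype c]
    (X : a → b → c → ℝ) : ℝ :=
  Real.sqrt (∑ i, ∑ j, ∑ k, (X i j k) ^ 2)

/-- Mode-1 product of an order-3 tensor with a matrix. -/
def mode1 {d1 d2 d3 p : Type*} [Fintype d1] (X : d1 → d2 → d3 → ℝ)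
    (A : Matrix p d1 ℝ) : p → d2 → d3 → ℝ :=
  fun s j k => ∑ i, A s i * X i j k

/-- Mode-2 product of an order-3 tensor with a matrix. -/
def mode2 {d1 d2 d3 p : Type*} [Fintype d2] (X : d1 → d2 → d3 → ℝ)
    (B : Matrix p d2 ℝ) : d1 → p → d3 → ℝ :=
  fun i s k => ∑ j, B s j * X i j k

/-! ### Squared Frobenius norm -/

/-- Squared Frobenius norm. -/
def n2 {a b : Type*} [Fintype a] [Fintype b] (A : Matrix a b ℝ) : ℝ :=
  ∑ i, ∑ j, (A i j) ^ 2

section FrobSq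
variable {a b c : Type*} [Fintype a] [Fintype b] [Fintype c]

lemma n2_nonneg (A : Matrix a b ℝ) : 0 ≤ n2 A :=
  Finset.sum_nonneg fun _ _ => Finset.sum_nonneg fun _ _ => sq_nonneg _

lemma frobNorm_eq (A : Matrix a b ℝ) : frobNorm A = Real.sqrt (n2 A) := rfl

lemma frobNorm_sq (A : Matrix a b ℝ) : frobNorm A ^ 2 = n2 A := by
  rw [frobNorm_eq, Real.sq_sqrt (n2_nonneg A)]

lemma n2_eq_trace (A : Matrix a b ℝ) : n2 A = (A * Aᵀ).trace := by
  simp [n2, Matrix.trace, Matrix.mul_apply, pow_two]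

lemma n2_transpose (A : Matrix a b ℝ) : n2 Aᵀ = n2 A := by
  unfold n2; rw [Finset.sum_comm]; rfl

lemma n2_entry_le (A : Matrix a b ℝ) (i : a) (j : b) : (A i j) ^ 2 ≤ n2 A := by
  unfold n2
  calc (A i j) ^ 2 ≤ ∑ j, (A i j) ^ 2 :=
        Finset.single_le_sum (f := fun j => (A i j) ^ 2) (fun _ _ => sq_nonneg _) (Finset.mem_univ j)
    _ ≤ _ := Finset.single_le_sum (f := fun i => ∑ j, (A i j) ^ 2)
        (fun _ _ => Finset.sum_nonneg fun _ _ => sq_nonneg _) (Finset.mem_univ i)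

lemma n2_mul_le (A : Matrix a b ℝ) (B : Matrix b c ℝ) : n2 (A * B) ≤ n2 A * n2 B := by
  have h : n2 A * n2 B = ∑ i, ∑ k, (∑ j, A i j ^ 2) * (∑ j, B j k ^ 2) := by
    unfold n2
    rw [Finset.sum_mul]
    refine Finset.sum_congr rfl fun i _ => ?_
    rw [← Finset.mul_sum, Finset.sum_comm (f := fun i j => B i j ^ 2)]
  rw [h]
  refine Finset.sum_le_sum fun i _ => Finset.sum_le_sum fun k _ => ?_
  rw [Matrix.mul_apply]
  exact Finset.sum_mul_sq_le_sq_mul_sq _ _ _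

lemma n2_add_le (A B : Matrix a b ℝ) : n2 (A + B) ≤ 2 * (n2 A + n2 B) := by
  unfold n2
  rw [← Finset.sum_add_distrib, Finset.mul_sum]
  refine Finset.sum_le_sum fun i _ => ?_
  rw [← Finset.sum_add_distrib, Finset.mul_sum]
  refine Finset.sum_le_sum fun k _ => ?_
  simp only [Matrix.add_apply]
  nlinarith [sq_nonneg (A i k - B i k)]

lemma n2_add3_le (A B C : Matrix a b ℝ) : n2 (A + B + C) ≤ 3 * (n2 A + n2 B + n2 C) := by
  unfold n2
  simp only [← Finset.sum_add_distrib, Finset.mul_sum]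
  refine Finset.sum_le_sum fun i _ => Finset.sum_le_sum fun k _ => ?_
  simp only [Matrix.add_apply]
  nlinarith [sq_nonneg (A i k - B i k), sq_nonneg (A i k - C i k), sq_nonneg (B i k - C i k)]

lemma n2_eq_zero {A : Matrix a b ℝ} (h : n2 A = 0) : A = 0 := by
  ext i j
  have := n2_entry_le A i j
  rw [h] at this
  have h2 : (A i j) ^ 2 = 0 := le_antisymm this (sq_nonneg _)
  simpa using h2

/-- Left multiplication by a diagonal matrix with bounded squares. -/
lemma n2_diagonal_mul_le [DecidableEq a] (d : a → ℝ) (K : ℝ) (hd : ∀ i, d i ^ 2 ≤ K)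
    (A : Matrix a b ℝ) : n2 (Matrix.diagonal d * A) ≤ K * n2 A := by
  unfold n2
  simp only [Finset.mul_sum, Matrix.diagonal_mul]
  refine Finset.sum_le_sum fun i _ => Finset.sum_le_sum fun k _ => ?_
  rw [mul_pow]
  exact mul_le_mul_of_nonneg_right (hd i) (sq_nonneg _)

/-- Bilinear bound through the Frobenius norm. -/
lemma dot_mulVec_sq_le (A : Matrix a b ℝ) (x : a → ℝ) (y : b → ℝ) :
    (x ⬝ᵥ A.mulVec y) ^ 2 ≤ n2 A * (x ⬝ᵥ x) * (y ⬝ᵥ y) := by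
  have h1 : (x ⬝ᵥ A.mulVec y) ^ 2 ≤ (∑ i, x i ^ 2) * ∑ i, (A.mulVec y i) ^ 2 :=
    Finset.sum_mul_sq_le_sq_mul_sq _ _ _
  have h2 : ∑ i, (A.mulVec y i) ^ 2 ≤ n2 A * (y ⬝ᵥ y) := by
    unfold n2
    rw [Finset.sum_mul]
    refine Finset.sum_le_sum fun i _ => ?_
    have := Finset.sum_mul_sq_le_sq_mul_sq Finset.univ (A i) y
    simpa [Matrix.mulVec, dotProduct, pow_two] using this
  have h3 : ∑ i, x i ^ 2 = x ⬝ᵥ x := by simp [dotProduct, pow_two]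
  rw [h3] at h1
  have h4 : 0 ≤ x ⬝ᵥ x := by rw [← h3]; exact Finset.sum_nonneg fun _ _ => sq_nonneg _
  calc _ ≤ _ := h1
    _ ≤ (x ⬝ᵥ x) * (n2 A * (y ⬝ᵥ y)) := mul_le_mul_of_nonneg_left h2 h4
    _ = _ := by ring

/-- Cauchy–Schwarz for averaged products. -/
lemma n2_avg_mul_le (T : ℕ) (G : ℕ → Matrix a b ℝ) (Y : ℕ → Matrix b c ℝ) :
    n2 ((T : ℝ)⁻¹ • ∑ t ∈ Finset.Icc 1 T, G t * Y t) ≤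
      ((T : ℝ)⁻¹ * ∑ t ∈ Finset.Icc 1 T, n2 (G t)) *
      ((T : ℝ)⁻¹ * ∑ t ∈ Finset.Icc 1 T, n2 (Y t)) := by
  have h : (∑ t ∈ Finset.Icc 1 T, n2 (G t)) * (∑ t ∈ Finset.Icc 1 T, n2 (Y t)) =
      ∑ i, ∑ k, (∑ p ∈ Finset.Icc 1 T ×ˢ (Finset.univ : Finset b), G p.1 i p.2 ^ 2) *
        (∑ p ∈ Finset.Icc 1 T ×ˢ (Finset.univ : Finset b), Y p.1 p.2 k ^ 2) := by
    unfold n2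
    simp only [Finset.sum_product]
    simp only [← Finset.mul_sum]
    rw [← Finset.sum_mul]
    congr 1
    · exact Finset.sum_comm
    · rw [Finset.sum_comm (s := (Finset.univ : Finset c))]
      exact Finset.sum_congr rfl fun t _ => Finset.sum_comm
  have h2 : n2 ((T : ℝ)⁻¹ • ∑ t ∈ Finset.Icc 1 T, G t * Y t) =
      (T : ℝ)⁻¹ ^ 2 * ∑ i, ∑ k, (∑ p ∈ Finset.Icc 1 T ×ˢ (Finset.univ : Finset b),
        G p.1 i p.2 * Y p.1 p.2 k) ^ 2 := by
    unfold n2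
    simp only [Finset.mul_sum]
    refine Finset.sum_congr rfl fun i _ => Finset.sum_congr rfl fun k _ => ?_
    rw [Matrix.smul_apply, Matrix.sum_apply, smul_eq_mul, mul_pow, Finset.sum_product]
    simp only [Matrix.mul_apply]
  have h3 : ((T : ℝ)⁻¹ * ∑ t ∈ Finset.Icc 1 T, n2 (G t)) *
      ((T : ℝ)⁻¹ * ∑ t ∈ Finset.Icc 1 T, n2 (Y t)) = (T : ℝ)⁻¹ ^ 2 *
      ((∑ t ∈ Finset.Icc 1 T, n2 (G t)) * (∑ t ∈ Finset.Icc 1 T, n2 (Y t))) := by ring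
  rw [h2, h3, h]
  refine mul_le_mul_of_nonneg_left ?_ (sq_nonneg _)
  refine Finset.sum_le_sum fun i _ => Finset.sum_le_sum fun k _ => ?_
  exact Finset.sum_mul_sq_le_sq_mul_sq _ _ _

end FrobSq

/-! ### Eigenvalue perturbation -/

lemma dot_self_nonneg {a : Type*} [Fintype a] (x : a → ℝ) : 0 ≤ x ⬝ᵥ x :=
  Finset.sum_nonneg fun _ _ => mul_self_nonneg _

/-- Dimension count. -/
lemma exists_coeff {r : ℕ} (Q : Matrix (Fin r) (Fin r) ℝ) (j : Fin r) :
    ∃ c : Fin r → ℝ, c ≠ 0 ∧ (∀ k, j < k → c k = 0) ∧ ∀ i, i < j → Q.mulVec c i = 0 := by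
  classical
  let L : (Fin r → ℝ) →ₗ[ℝ] ({i : Fin r // i ≠ j} → ℝ) :=
    { toFun := fun c i => if i.1 < j then Q.mulVec c i.1 else c i.1
      map_add' := by
        intro x y; ext i; by_cases h : i.1 < j <;> simp [h, Matrix.mulVec_add]
      map_smul' := by
        intro s x; ext i; by_cases h : i.1 < j <;> simp [h, Matrix.mulVec_smul] }
  have hd : Module.finrank ℝ ({i : Fin r // i ≠ j} → ℝ) < Module.finrank ℝ (Fin r → ℝ) := by
    simp only [Module.finrank_fintype_fun_eq_card]
    exact Fintype.card_subtype_lt (x := j) (by simp)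
  obtain ⟨c, hc, hc0⟩ := (Submodule.ne_bot_iff _).1 (LinearMap.ker_ne_bot_of_finrank_lt (f := L) hd)
  refine ⟨c, hc0, ?_, ?_⟩
  · intro k hk
    have := congrFun (LinearMap.mem_ker.1 hc) ⟨k, hk.ne'⟩
    simpa [L, not_lt.2 hk.le] using this
  · intro i hi
    have := congrFun (LinearMap.mem_ker.1 hc) ⟨i, hi.ne⟩
    simpa [L, hi] using this

lemma dot_self_pos {a : Type*} [Fintype a] {x : a → ℝ} (h : x ≠ 0) : 0 < x ⬝ᵥ x :=
  lt_of_le_of_ne (dot_self_nonneg x) fun h' => h (dotProduct_self_eq_zero.1 h'.symm)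

lemma dot_mulVec_orth {m r : ℕ} {V : Matrix (Fin m) (Fin r) ℝ} (hV : Vᵀ * V = 1)
    (c d : Fin r → ℝ) : V.mulVec c ⬝ᵥ V.mulVec d = c ⬝ᵥ d := by
  rw [Matrix.dotProduct_mulVec, ← Matrix.mulVec_transpose, Matrix.mulVec_mulVec, hV, Matrix.one_mulVec]

/-- Bessel. -/
lemma bessel {m r : ℕ} {V : Matrix (Fin m) (Fin r) ℝ} (hV : Vᵀ * V = 1) (x : Fin m → ℝ) :
    Vᵀ.mulVec x ⬝ᵥ Vᵀ.mulVec x ≤ x ⬝ᵥ x := by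
  have h := dot_self_nonneg (x - V.mulVec (Vᵀ.mulVec x))
  rw [sub_dotProduct, dotProduct_sub, dotProduct_sub, dot_mulVec_orth hV] at h
  have h1 : x ⬝ᵥ V.mulVec (Vᵀ.mulVec x) = Vᵀ.mulVec x ⬝ᵥ Vᵀ.mulVec x := by
    rw [Matrix.dotProduct_mulVec, ← Matrix.mulVec_transpose]
  rw [dotProduct_comm (V.mulVec (Vᵀ.mulVec x)) x, h1] at h
  linarith

/-- quadratic form of `V diag μ Vᵀ`. -/
lemma quad_spec {m r : ℕ} (V : Matrix (Fin m) (Fin r) ℝ) (μ : Fin r → ℝ) (x : Fin m → ℝ) :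
    x ⬝ᵥ (V * Matrix.diagonal μ * Vᵀ).mulVec x = ∑ i, μ i * (Vᵀ.mulVec x i) ^ 2 := by
  rw [← Matrix.mulVec_mulVec, ← Matrix.mulVec_mulVec, Matrix.dotProduct_mulVec,
    ← Matrix.mulVec_transpose]
  simp only [dotProduct, Matrix.mulVec_diagonal]
  exact Finset.sum_congr rfl fun i _ => by ring

/-- Rayleigh bound on the orthogonal complement of the top eigenvectors. -/
lemma rayleigh_compl {m r : ℕ} {G : Matrix (Fin m) (Fin m) ℝ} (hG : Gᵀ = G)
    {V : Matrix (Fin m) (Fin r) ℝ} (hV : Vᵀ * V = 1) {μ : Fin r → ℝ}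
    (hE : G * V = V * Matrix.diagonal μ)
    (hTop : ∀ (ν' : ℝ) (x : Fin m → ℝ), x ≠ 0 → G.mulVec x = ν' • x → Vᵀ.mulVec x = 0 →
      ∀ j, ν' ≤ μ j) (j : Fin r) (x : Fin m → ℝ) :
    x ⬝ᵥ G.mulVec x ≤ ∑ i, μ i * (Vᵀ.mulVec x i) ^ 2
      + μ j * (x ⬝ᵥ x - Vᵀ.mulVec x ⬝ᵥ Vᵀ.mulVec x) := by
  have hE' : Vᵀ * G = Matrix.diagonal μ * Vᵀ := by
    have := congrArg Matrix.transpose hE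
    simpa [Matrix.transpose_mul, hG] using this
  set B : Matrix (Fin m) (Fin m) ℝ :=
    μ j • (1 - V * Vᵀ) - (G - V * Matrix.diagonal μ * Vᵀ) with hB
  have hBH : B.IsHermitian := by
    unfold Matrix.IsHermitian
    rw [Matrix.conjTranspose_eq_transpose_of_trivial]
    simp [hB, Matrix.transpose_mul, hG, Matrix.mul_assoc]
  have hVB : Vᵀ * B = 0 := by
    have e1 : Vᵀ * (V * Vᵀ) = Vᵀ := by rw [← Matrix.mul_assoc, hV, Matrix.one_mul]
    have e2 : Vᵀ * (V * Matrix.diagonal μ * Vᵀ) = Matrix.diagonal μ * Vᵀ := by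
      rw [← Matrix.mul_assoc, ← Matrix.mul_assoc, hV, Matrix.one_mul]
    rw [hB, Matrix.mul_sub, Matrix.mul_smul, Matrix.mul_sub, Matrix.mul_sub, e1, e2, hE']
    simp
  have hpsd : B.PosSemidef := by
    rw [hBH.posSemidef_iff_eigenvalues_nonneg]
    intro i
    by_contra hneg
    simp only [Pi.zero_apply, not_le] at hneg
    set u : Fin m → ℝ := (hBH.eigenvectorBasis i).ofLp with hu
    have hu0 : u ≠ 0 := by
      intro h0
      have h1 := hBH.eigenvectorBasis.orthonormal.ne_zero i
      apply h1
      ext k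
      exact congrFun h0 k
    have hev : B.mulVec u = hBH.eigenvalues i • u := hBH.mulVec_eigenvectorBasis i
    have hVu : Vᵀ.mulVec u = 0 := by
      have h1 : Vᵀ.mulVec (B.mulVec u) = 0 := by
        rw [Matrix.mulVec_mulVec, hVB, Matrix.zero_mulVec]
      rw [hev, Matrix.mulVec_smul] at h1
      exact (smul_eq_zero.1 h1).resolve_left hneg.ne
    have hBu : B.mulVec u = μ j • u - G.mulVec u := by
      rw [hB, Matrix.sub_mulVec, Matrix.smul_mulVec, Matrix.sub_mulVec, Matrix.sub_mulVec,
        ← Matrix.mulVec_mulVec, ← Matrix.mulVec_mulVec, hVu]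
      simp
    have hGu : G.mulVec u = (μ j - hBH.eigenvalues i) • u := by
      rw [sub_smul, ← hev, hBu]; abel
    have := hTop _ u hu0 hGu hVu j
    linarith
  have h := hpsd.dotProduct_mulVec_nonneg x
  have hVV : x ⬝ᵥ (V * Vᵀ).mulVec x = Vᵀ.mulVec x ⬝ᵥ Vᵀ.mulVec x := by
    rw [← Matrix.mulVec_mulVec, Matrix.dotProduct_mulVec, ← Matrix.mulVec_transpose]
  have hs : star x = x := by ext; simp
  rw [hs, hB, Matrix.sub_mulVec, Matrix.smul_mulVec, Matrix.sub_mulVec, Matrix.sub_mulVec,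
    dotProduct_sub, dotProduct_smul, dotProduct_sub, dotProduct_sub, quad_spec, hVV,
    Matrix.one_mulVec, smul_eq_mul] at h
  linarith

/-- One-sided Weyl inequality. -/
lemma weyl_one {m r : ℕ} {G₁ G₂ : Matrix (Fin m) (Fin m) ℝ}
    {V₁ V₂ : Matrix (Fin m) (Fin r) ℝ} (hV₁ : V₁ᵀ * V₁ = 1) {μ₁ μ₂ : Fin r → ℝ}
    (hE : G₁ * V₁ = V₁ * Matrix.diagonal μ₁) (ha₁ : Antitone μ₁) (ha₂ : Antitone μ₂)
    (j : Fin r)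
    (hR : ∀ x, x ⬝ᵥ G₂.mulVec x ≤ ∑ i, μ₂ i * (V₂ᵀ.mulVec x i) ^ 2
      + μ₂ j * (x ⬝ᵥ x - V₂ᵀ.mulVec x ⬝ᵥ V₂ᵀ.mulVec x))
    {δ : ℝ} (hδ : 0 ≤ δ) (hΔ : n2 (G₁ - G₂) ≤ δ ^ 2) : μ₁ j ≤ μ₂ j + δ := by
  obtain ⟨c, hc0, hcs, hcz⟩ := exists_coeff (V₂ᵀ * V₁) j
  set x := V₁.mulVec c with hx
  have hxx : x ⬝ᵥ x = c ⬝ᵥ c := dot_mulVec_orth hV₁ c c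
  have hpos : 0 < c ⬝ᵥ c := dot_self_pos hc0
  have h1 : μ₁ j * (c ⬝ᵥ c) ≤ x ⬝ᵥ G₁.mulVec x := by
    have : G₁.mulVec x = V₁.mulVec ((Matrix.diagonal μ₁).mulVec c) := by
      rw [hx, Matrix.mulVec_mulVec, hE, Matrix.mulVec_mulVec]
    rw [this, hx, dot_mulVec_orth hV₁]
    simp only [dotProduct, Matrix.mulVec_diagonal, Finset.mul_sum]
    refine Finset.sum_le_sum fun i _ => ?_
    by_cases hi : j < i
    · simp [hcs i hi]
    · have := ha₁ (not_lt.1 hi)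
      nlinarith [mul_self_nonneg (c i)]
  have h2 : x ⬝ᵥ G₂.mulVec x ≤ μ₂ j * (c ⬝ᵥ c) := by
    refine (hR x).trans ?_
    rw [hxx]
    have : ∑ i, μ₂ i * (V₂ᵀ.mulVec x i) ^ 2 ≤ μ₂ j * (V₂ᵀ.mulVec x ⬝ᵥ V₂ᵀ.mulVec x) := by
      simp only [dotProduct, Finset.mul_sum]
      refine Finset.sum_le_sum fun i _ => ?_
      by_cases hi : i < j
      · have := hcz i hi
        rw [← Matrix.mulVec_mulVec] at this
        rw [this]; simp
      · have := ha₂ (not_lt.1 hi)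
        nlinarith [sq_nonneg (V₂ᵀ.mulVec x i)]
    linarith
  have h3 : x ⬝ᵥ (G₁ - G₂).mulVec x ≤ δ * (c ⬝ᵥ c) := by
    have := dot_mulVec_sq_le (G₁ - G₂) x x
    rw [hxx] at this
    refine abs_le_of_sq_le_sq' ?_ (by positivity) |>.2
    nlinarith [mul_nonneg hpos.le hpos.le]
  rw [Matrix.sub_mulVec, dotProduct_sub] at h3
  have : μ₁ j * (c ⬝ᵥ c) ≤ (μ₂ j + δ) * (c ⬝ᵥ c) := by linarith
  exact le_of_mul_le_mul_right this hpos

/-- Two-sided Weyl inequality for the top eigenvalues. -/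
lemma weyl {m r : ℕ} {V Vh : Matrix (Fin m) (Fin r) ℝ} (hV : Vᵀ * V = 1) (hVh : Vhᵀ * Vh = 1)
    {μ μh : Fin r → ℝ} (hpos : ∀ j, 0 < μ j) (ha : Antitone μ) (hah : Antitone μh)
    {Gh : Matrix (Fin m) (Fin m) ℝ} (hG : Ghᵀ = Gh)
    (hE : Gh * Vh = Vh * Matrix.diagonal μh)
    (hTop : ∀ (ν' : ℝ) (x : Fin m → ℝ), x ≠ 0 → Gh.mulVec x = ν' • x → Vhᵀ.mulVec x = 0 →
      ∀ j, ν' ≤ μh j)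
    {δ : ℝ} (hδ : 0 ≤ δ) (hΔ : n2 (Gh - V * Matrix.diagonal μ * Vᵀ) ≤ δ ^ 2) (j : Fin r) :
    |μh j - μ j| ≤ δ := by
  have h1 : μh j ≤ μ j + δ := by
    refine weyl_one hVh hE hah ha j (V₂ := V) (fun x => ?_) hδ hΔ
    rw [quad_spec]
    have := mul_nonneg (hpos j).le (sub_nonneg.2 (bessel hV x))
    linarith
  have h2 : μ j ≤ μh j + δ := by
    refine weyl_one hV (G₁ := V * Matrix.diagonal μ * Vᵀ) ?_ ha hah j (V₂ := Vh)
      (fun x => rayleigh_compl hG hVh hE hTop j x) hδ ?_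
    · rw [Matrix.mul_assoc, hV, Matrix.mul_one]
    · have : n2 (V * Matrix.diagonal μ * Vᵀ - Gh) = n2 (Gh - V * Matrix.diagonal μ * Vᵀ) := by
        unfold n2
        refine Finset.sum_congr rfl fun i _ => Finset.sum_congr rfl fun k _ => ?_
        simp only [Matrix.sub_apply]; ring
      rw [this]; exact hΔ
  rw [abs_le]; constructor <;> linarith

/-- Overlap of one empirical eigenvector with the population ones. -/
lemma overlap {m r : ℕ} {V : Matrix (Fin m) (Fin r) ℝ} (hV : Vᵀ * V = 1)
    {μ : Fin r → ℝ} {Gh : Matrix (Fin m) (Fin m) ℝ} {v : Fin m → ℝ} (hv : v ⬝ᵥ v = 1) {l : ℝ}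
    (hE : Gh.mulVec v = l • v) {g δ : ℝ} (hg : 0 < g) (j : Fin r)
    (hgap : ∀ i, i ≠ j → g ≤ |l - μ i|) (hl : g ≤ l)
    (hΔ : n2 (Gh - V * Matrix.diagonal μ * Vᵀ) ≤ δ ^ 2) :
    g ^ 2 * (1 - (Vᵀ.mulVec v j) ^ 2) ≤ δ ^ 2 := by
  set q := Vᵀ.mulVec v with hq
  set w : Fin m → ℝ := v - V.mulVec q with hw
  set D := Gh - V * Matrix.diagonal μ * Vᵀ with hD
  have hVw : Vᵀ.mulVec w = 0 := by
    rw [hw, Matrix.mulVec_sub, Matrix.mulVec_mulVec, hV, Matrix.one_mulVec, sub_self]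
  have hDv : D.mulVec v = V.mulVec (fun i => (l - μ i) * q i) + l • w := by
    have e1 : (V * Matrix.diagonal μ * Vᵀ).mulVec v = V.mulVec (fun i => μ i * q i) := by
      rw [← Matrix.mulVec_mulVec, ← Matrix.mulVec_mulVec, ← hq]
      congr 1; ext i; rw [Matrix.mulVec_diagonal]
    have e2 : (fun i => (l - μ i) * q i) = l • q - fun i => μ i * q i := by
      ext i; simp; ring
    rw [hD, Matrix.sub_mulVec, hE, e1, e2, Matrix.mulVec_sub, Matrix.mulVec_smul, hw, smul_sub]
    abel
  have hcross : ∀ c, V.mulVec c ⬝ᵥ w = 0 := by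
    intro c
    rw [dotProduct_comm, Matrix.dotProduct_mulVec, ← Matrix.mulVec_transpose, hVw, zero_dotProduct]
  have hn : D.mulVec v ⬝ᵥ D.mulVec v = ∑ i, (l - μ i) ^ 2 * q i ^ 2 + l ^ 2 * (w ⬝ᵥ w) := by
    rw [hDv, add_dotProduct, dotProduct_add, dotProduct_add, dot_mulVec_orth hV, dotProduct_smul,
      smul_dotProduct, smul_dotProduct, hcross, dotProduct_comm w, hcross, dotProduct_smul]
    simp only [dotProduct, smul_eq_mul, mul_zero, add_zero, zero_add]
    congr 1
    · exact Finset.sum_congr rfl fun i _ => by ring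
    · ring
  have hvv : ∑ i, q i ^ 2 + w ⬝ᵥ w = 1 := by
    have : v = V.mulVec q + w := by rw [hw]; abel
    rw [← hv]
    conv_rhs => rw [this]
    rw [add_dotProduct, dotProduct_add, dotProduct_add, dot_mulVec_orth hV, hcross,
      dotProduct_comm w (V.mulVec q), hcross]
    simp [dotProduct, pow_two]
  have hDb : D.mulVec v ⬝ᵥ D.mulVec v ≤ δ ^ 2 := by
    have h1 := dot_mulVec_sq_le D (D.mulVec v) v
    rw [hv, mul_one] at h1
    rcases (dot_self_nonneg (D.mulVec v)).eq_or_lt with h0 | h0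
    · rw [← h0]; positivity
    · have : D.mulVec v ⬝ᵥ D.mulVec v ≤ n2 D := by
        rw [pow_two] at h1
        exact le_of_mul_le_mul_right h1 h0
      linarith
  have h5 : g ^ 2 * (∑ i, q i ^ 2 - q j ^ 2) ≤ ∑ i, (l - μ i) ^ 2 * q i ^ 2 := by
    rw [← Finset.add_sum_erase _ _ (Finset.mem_univ j),
      ← Finset.add_sum_erase _ (fun i => (l - μ i) ^ 2 * q i ^ 2) (Finset.mem_univ j),
      add_sub_cancel_left, Finset.mul_sum]
    have : ∑ i ∈ Finset.univ.erase j, g ^ 2 * q i ^ 2 ≤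
        ∑ i ∈ Finset.univ.erase j, (l - μ i) ^ 2 * q i ^ 2 := by
      refine Finset.sum_le_sum fun i hi => ?_
      refine mul_le_mul_of_nonneg_right ?_ (sq_nonneg _)
      have := hgap i (Finset.ne_of_mem_erase hi)
      rw [← sq_abs (l - μ i)]
      exact pow_le_pow_left₀ hg.le this 2
    have h6 : 0 ≤ (l - μ j) ^ 2 * q j ^ 2 := by positivity
    linarith
  have h7 : g ^ 2 * (w ⬝ᵥ w) ≤ l ^ 2 * (w ⬝ᵥ w) :=
    mul_le_mul_of_nonneg_right (pow_le_pow_left₀ hg.le hl 2) (dot_self_nonneg w)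
  have : 1 - q j ^ 2 = (∑ i, q i ^ 2 - q j ^ 2) + w ⬝ᵥ w := by rw [← hvv]; ring
  rw [this, mul_add]
  linarith

/-- Sign matrix entries. -/
noncomputable def sgnVec {m r : ℕ} (V Vh : Matrix (Fin m) (Fin r) ℝ) (j : Fin r) : ℝ :=
  if 0 ≤ (Vhᵀ * V) j j then 1 else -1

lemma sgnVec_or {m r : ℕ} (V Vh : Matrix (Fin m) (Fin r) ℝ) (j : Fin r) :
    sgnVec V Vh j = 1 ∨ sgnVec V Vh j = -1 := by
  unfold sgnVec; split_ifs <;> simp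

lemma sgnVec_sq {m r : ℕ} (V Vh : Matrix (Fin m) (Fin r) ℝ) (j : Fin r) :
    sgnVec V Vh j ^ 2 = 1 := by
  rcases sgnVec_or V Vh j with h | h <;> rw [h] <;> norm_num

lemma sgnVec_mul {m r : ℕ} (V Vh : Matrix (Fin m) (Fin r) ℝ) (j : Fin r) :
    sgnVec V Vh j * (Vhᵀ * V) j j = |(Vhᵀ * V) j j| := by
  unfold sgnVec
  split_ifs with h
  · rw [abs_of_nonneg h, one_mul]
  · rw [abs_of_neg (not_le.1 h)]; ring

lemma scalar_diag {mu muh q s g δ η : ℝ} (hg : 0 < g) (hmu : 0 < mu) (hmuh : g / 2 ≤ muh)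
    (hd : |muh - mu| ≤ δ) (hη : 4 * δ ^ 2 = η * g ^ 2) (hη1 : η ≤ 1)
    (hs : s = 1 ∨ s = -1) (hsq : s * q = |q|) (hq1 : |q| ≤ 1) (hq : 1 - |q| ≤ η) (hδ : 0 ≤ δ) :
    ((Real.sqrt muh)⁻¹ * q * Real.sqrt mu - s) ^ 2 ≤ 4 * η := by
  have hmuh0 : 0 < muh := by linarith
  set x := (Real.sqrt muh)⁻¹ * Real.sqrt mu with hx
  have hx0 : 0 ≤ x := by positivity
  have hx2 : x ^ 2 = mu / muh := by
    rw [hx, mul_pow, inv_pow, Real.sq_sqrt hmuh0.le, Real.sq_sqrt hmu.le]; field_simp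
  have hη0 : 0 ≤ η := by
    by_contra h
    nlinarith [sq_nonneg δ, pow_pos hg 2]
  have hk : |x - 1| ≤ Real.sqrt η := by
    have h1 : |x - 1| ≤ |x ^ 2 - 1| := by
      have : x ^ 2 - 1 = (x - 1) * (x + 1) := by ring
      rw [this, abs_mul]
      have : 1 ≤ |x + 1| := by rw [abs_of_nonneg (by linarith)]; linarith
      nlinarith [abs_nonneg (x - 1)]
    have h2 : |x ^ 2 - 1| ≤ 2 * δ / g := by
      rw [hx2]
      have : mu / muh - 1 = (mu - muh) / muh := by field_simp
      rw [this, abs_div, abs_of_pos hmuh0, abs_sub_comm, div_le_div_iff₀ hmuh0 hg]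
      nlinarith
    have h3 : 2 * δ / g = Real.sqrt η := by
      rw [eq_comm, Real.sqrt_eq_iff_eq_sq hη0 (by positivity)]
      field_simp; linarith
    linarith
  have hs2 : s * s = 1 := by rcases hs with h | h <;> rw [h] <;> norm_num
  have e : (Real.sqrt muh)⁻¹ * q * Real.sqrt mu - s = s * (x * |q| - 1) := by
    rw [← hsq]
    linear_combination -((Real.sqrt muh)⁻¹ * q * Real.sqrt mu) * hs2
  rw [e, mul_pow, pow_two s, hs2, one_mul]
  have hse : η ≤ Real.sqrt η := by
    rw [Real.le_sqrt hη0 hη0]; nlinarith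
  have hsn := Real.sqrt_nonneg η
  have hb : |x * |q| - 1| ≤ 2 * Real.sqrt η := by
    have : x * |q| - 1 = (x - 1) * |q| - (1 - |q|) := by ring
    rw [this]
    refine (abs_sub _ _).trans ?_
    rw [abs_mul, abs_abs, abs_of_nonneg (sub_nonneg.2 hq1)]
    nlinarith [abs_nonneg (x - 1), abs_nonneg q]
  calc (x * |q| - 1) ^ 2 = |x * |q| - 1| ^ 2 := (sq_abs _).symm
    _ ≤ (2 * Real.sqrt η) ^ 2 := pow_le_pow_left₀ (abs_nonneg _) hb 2
    _ = 4 * η := by rw [mul_pow, Real.sq_sqrt hη0]; norm_num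

lemma perturb {m r : ℕ} {V Vh : Matrix (Fin m) (Fin r) ℝ} (hV : Vᵀ * V = 1) (hVh : Vhᵀ * Vh = 1)
    {μ μh : Fin r → ℝ} (ha : Antitone μ) (hah : Antitone μh)
    {Gh : Matrix (Fin m) (Fin m) ℝ} (hG : Ghᵀ = Gh)
    (hE : Gh * Vh = Vh * Matrix.diagonal μh)
    (hTop : ∀ (ν' : ℝ) (x : Fin m → ℝ), x ≠ 0 → Gh.mulVec x = ν' • x → Vhᵀ.mulVec x = 0 →
      ∀ j, ν' ≤ μh j)
    {g h δ η : ℝ} (hg : 0 < g) (hgap : ∀ i j, i ≠ j → g ≤ |μ i - μ j|)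
    (hlow : ∀ j, g ≤ μ j) (hup : ∀ j, μ j ≤ h)
    (hδ : 0 ≤ δ) (hδg : δ ≤ g / 2) (hη : 4 * δ ^ 2 = η * g ^ 2)
    (hΔ : n2 (Gh - V * Matrix.diagonal μ * Vᵀ) ≤ δ ^ 2) :
    (∀ j, g / 2 ≤ μh j) ∧
    n2 (Vh - V * Matrix.diagonal (sgnVec V Vh)) ≤ r * (2 * η) ∧
    n2 (Matrix.diagonal (fun j => (Real.sqrt (μh j))⁻¹) * Vhᵀ * V *
        Matrix.diagonal (fun j => Real.sqrt (μ j)) - Matrix.diagonal (sgnVec V Vh))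
      ≤ r * (r * ((2 * h / g + 4) * η)) := by
  have hμpos : ∀ j, 0 < μ j := fun j => hg.trans_le (hlow j)
  have hW := weyl hV hVh hμpos ha hah hG hE hTop hδ hΔ
  have hη0 : 0 ≤ η := by
    by_contra h
    nlinarith [sq_nonneg δ, pow_pos hg 2]
  have hη1 : η ≤ 1 := by
    have : η * g ^ 2 ≤ 1 * g ^ 2 := by rw [← hη]; nlinarith
    exact le_of_mul_le_mul_right this (by positivity)
  have hlo : ∀ j, g / 2 ≤ μh j := by
    intro j
    have h1 := abs_le.1 (hW j)
    have h2 := hlow j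
    linarith [h1.1]
  -- columns
  have hcol : ∀ i j, (Vhᵀ * V) j i = Vᵀ.mulVec (fun k => Vh k j) i := by
    intro i j
    simp only [Matrix.mul_apply, Matrix.mulVec, dotProduct, Matrix.transpose_apply]
    exact Finset.sum_congr rfl fun k _ => mul_comm _ _
  have hunit : ∀ j, (fun k => Vh k j) ⬝ᵥ (fun k => Vh k j) = 1 := by
    intro j
    have := congrFun (congrFun hVh j) j
    simpa [Matrix.mul_apply, dotProduct] using this
  have hunitV : ∀ j, (fun k => V k j) ⬝ᵥ (fun k => V k j) = 1 := by
    intro j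
    have := congrFun (congrFun hV j) j
    simpa [Matrix.mul_apply, dotProduct] using this
  have hev : ∀ j, Gh.mulVec (fun k => Vh k j) = μh j • (fun k => Vh k j) := by
    intro j
    ext k
    have := congrFun (congrFun hE k) j
    rw [Matrix.mul_diagonal] at this
    simp only [Pi.smul_apply, smul_eq_mul]
    rw [mul_comm, ← this]; rfl
  have hov : ∀ j, 1 - ((Vhᵀ * V) j j) ^ 2 ≤ η := by
    intro j
    have h1 := overlap hV (hunit j) (hev j) (g := g / 2) (by positivity) j (μ := μ)
      (fun i hi => by
        have h2 := hgap j i hi.symm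
        have h3 := hW j
        have h4 : |μ j - μ i| ≤ |μh j - μ j| + |μh j - μ i| := by
          have : μ j - μ i = -(μh j - μ j) + (μh j - μ i) := by ring
          rw [this]
          exact (abs_add_le _ _).trans (by rw [abs_neg])
        linarith) (hlo j) hΔ
    rw [← hcol] at h1
    have : (1 - ((Vhᵀ * V) j j) ^ 2) * g ^ 2 ≤ η * g ^ 2 := by rw [← hη]; linarith
    exact le_of_mul_le_mul_right this (by positivity)
  have hbess : ∀ j, ∑ i, ((Vhᵀ * V) j i) ^ 2 ≤ 1 := by
    intro j
    have := bessel hV (fun k => Vh k j)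
    rw [hunit j] at this
    simpa [dotProduct, ← hcol, ← pow_two] using this
  have hq1 : ∀ j, |(Vhᵀ * V) j j| ≤ 1 := by
    intro j
    have h1 := Finset.single_le_sum (f := fun i => ((Vhᵀ * V) j i) ^ 2)
      (fun _ _ => sq_nonneg _) (Finset.mem_univ j)
    have h2 := h1.trans (hbess j)
    rw [← sq_le_one_iff_abs_le_one]; exact h2
  have hoff : ∀ j i, i ≠ j → ((Vhᵀ * V) j i) ^ 2 ≤ η := by
    intro j i hij
    have h1 := hbess j
    rw [← Finset.add_sum_erase _ _ (Finset.mem_univ j)] at h1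
    have h2 := Finset.single_le_sum (f := fun i => ((Vhᵀ * V) j i) ^ 2) (s := Finset.univ.erase j)
      (fun _ _ => sq_nonneg _) (Finset.mem_erase.2 ⟨hij, Finset.mem_univ i⟩)
    have h3 := hov j
    linarith
  have hq : ∀ j, 1 - |(Vhᵀ * V) j j| ≤ η := by
    intro j
    have h1 := hov j
    rw [← sq_abs] at h1
    nlinarith [hq1 j, abs_nonneg ((Vhᵀ * V) j j)]
  refine ⟨hlo, ?_, ?_⟩
  · rw [← n2_transpose]
    unfold n2
    have : ∀ j ∈ (Finset.univ : Finset (Fin r)), ∑ k, ((Vh - V * Matrix.diagonal (sgnVec V Vh))ᵀ j k) ^ 2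
        ≤ 2 * η := by
      intro j _
      have e : ∑ k, ((Vh - V * Matrix.diagonal (sgnVec V Vh))ᵀ j k) ^ 2
          = 2 - 2 * |(Vhᵀ * V) j j| := by
        rw [← sgnVec_mul]
        have e1 : ∀ k, ((Vh - V * Matrix.diagonal (sgnVec V Vh))ᵀ j k) ^ 2
            = Vh k j * Vh k j + V k j * V k j - 2 * sgnVec V Vh j * (Vh k j * V k j) := by
          intro k
          simp only [Matrix.transpose_apply, Matrix.sub_apply, Matrix.mul_diagonal]
          linear_combination (V k j) ^ 2 * sgnVec_sq V Vh j
        rw [Finset.sum_congr rfl fun k _ => e1 k, Finset.sum_sub_distrib, Finset.sum_add_distrib,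
          ← Finset.mul_sum]
        have e2 := hunit j
        have e3 := hunitV j
        simp only [dotProduct] at e2 e3
        rw [e2, e3, Matrix.mul_apply]
        simp only [Matrix.transpose_apply]
        ring
      rw [e]; linarith [hq j]
    refine (Finset.sum_le_card_nsmul _ _ _ this).trans ?_
    simp
  · unfold n2
    have hent : ∀ j i, ((Matrix.diagonal (fun j => (Real.sqrt (μh j))⁻¹) * Vhᵀ * V *
        Matrix.diagonal (fun j => Real.sqrt (μ j)) - Matrix.diagonal (sgnVec V Vh)) j i) ^ 2
        ≤ (2 * h / g + 4) * η := by
      intro j i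
      have hh0 : 0 < h := (hμpos j).trans_le (hup j)
      have hh : 0 ≤ 2 * h / g := by positivity
      rw [Matrix.sub_apply, Matrix.mul_diagonal, Matrix.mul_assoc, Matrix.diagonal_mul]
      by_cases hij : i = j
      · subst hij
        rw [Matrix.diagonal_apply_eq]
        refine (scalar_diag hg (hμpos i) (hlo i) (hW i) hη hη1 (sgnVec_or V Vh i)
          (sgnVec_mul V Vh i) (hq1 i) (hq i) hδ).trans ?_
        nlinarith
      · rw [Matrix.diagonal_apply_ne' _ hij, sub_zero, mul_pow, mul_pow, inv_pow,
          Real.sq_sqrt (hμpos i).le]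
        have h0 : 0 < μh j := by linarith [hlo j]
        rw [Real.sq_sqrt h0.le]
        have h1 : (μh j)⁻¹ ≤ 2 / g := by
          rw [inv_eq_one_div, div_le_div_iff₀ h0 hg]
          linarith [hlo j]
        have h2 := hoff j i hij
        calc (μh j)⁻¹ * (Vhᵀ * V) j i ^ 2 * μ i ≤ 2 / g * η * h := by
              have := hup i
              have := (hμpos i).le
              gcongr
          _ = 2 * h / g * η := by ring
          _ ≤ (2 * h / g + 4) * η := by nlinarith
    have h2 : ∀ j ∈ (Finset.univ : Finset (Fin r)), ∑ i, ((Matrix.diagonal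
        (fun j => (Real.sqrt (μh j))⁻¹) * Vhᵀ * V *
        Matrix.diagonal (fun j => Real.sqrt (μ j)) - Matrix.diagonal (sgnVec V Vh)) j i) ^ 2
        ≤ r * ((2 * h / g + 4) * η) := by
      intro j _
      refine (Finset.sum_le_card_nsmul _ _ _ fun i _ => hent j i).trans ?_
      simp
    refine (Finset.sum_le_card_nsmul _ _ _ h2).trans ?_
    simp

/-- Contraction matrix: `(D * ymat y) k i = ∑ j, D k (i,j) * y j`. -/
def ymat {N : ℕ} (y : Fin N → ℝ) : Matrix (Fin N × Fin N) (Fin N) ℝ :=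
  Matrix.of fun p i => if p.1 = i then y p.2 else 0

lemma mul_ymat {N : ℕ} {a : Type*} (D : Matrix a (Fin N × Fin N) ℝ) (y : Fin N → ℝ) (k : a)
    (i : Fin N) : (D * ymat y) k i = ∑ j, D k (i, j) * y j := by
  rw [Matrix.mul_apply, Fintype.sum_prod_type, Finset.sum_eq_single i]
  · simp [ymat]
  · intro b _ hb; simp [ymat, hb]
  · simp

lemma n2_mul_ymat_le {N : ℕ} {a : Type*} [Fintype a] (D : Matrix a (Fin N × Fin N) ℝ)
    (y : Fin N → ℝ) : n2 (D * ymat y) ≤ n2 D * ∑ j, y j ^ 2 := by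
  unfold n2
  rw [Finset.sum_mul]
  refine Finset.sum_le_sum fun k _ => ?_
  rw [Fintype.sum_prod_type, Finset.sum_mul]
  refine Finset.sum_le_sum fun i _ => ?_
  rw [mul_ymat]
  exact Finset.sum_mul_sq_le_sq_mul_sq _ _ _

/-- Decomposition of the factor estimation error. -/
lemma decomp_bound {m r : ℕ} {n p : Type*} [Fintype n] [Fintype p] [DecidableEq n]
    {V Vh : Matrix (Fin m) (Fin r) ℝ}
    {μ μh : Fin r → ℝ} {g : ℝ} (hg : 0 < g) (hμ : ∀ j, 0 < μ j) (hμh : ∀ j, g / 2 ≤ μh j)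
    {χ E : Matrix (Fin m) n ℝ} (hχ : χ = V * Vᵀ * χ) {F Fh : Matrix (Fin r) n ℝ}
    (hF : F = Matrix.diagonal (fun j => (Real.sqrt (μ j))⁻¹) * Vᵀ * χ)
    (hFh : Fh = Matrix.diagonal (fun j => (Real.sqrt (μh j))⁻¹) * Vhᵀ * (χ + E))
    {a b : ℝ} (ha : n2 (Vh - V * Matrix.diagonal (sgnVec V Vh)) ≤ a)
    (hb : n2 (Matrix.diagonal (fun j => (Real.sqrt (μh j))⁻¹) * Vhᵀ * V *
        Matrix.diagonal (fun j => Real.sqrt (μ j)) - Matrix.diagonal (sgnVec V Vh)) ≤ b)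
    (Y : Matrix n p ℝ) :
    n2 ((Fh - Matrix.diagonal (sgnVec V Vh) * F) * Y) ≤
      3 * (b * n2 (F * Y) + 2 / g * (a * n2 (E * Y)) + 2 / g * n2 (Vᵀ * E * Y)) := by
  set J := Matrix.diagonal (sgnVec V Vh) with hJ
  set Mh := Matrix.diagonal (fun j => (Real.sqrt (μh j))⁻¹) with hMh
  set Ms := Matrix.diagonal (fun j => Real.sqrt (μ j)) with hMs
  have hχF : χ = V * Ms * F := by
    have : Ms * (Matrix.diagonal (fun j => (Real.sqrt (μ j))⁻¹) * Vᵀ * χ) = Vᵀ * χ := by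
      rw [← Matrix.mul_assoc, ← Matrix.mul_assoc, hMs, Matrix.diagonal_mul_diagonal]
      have : (fun i => Real.sqrt (μ i) * (Real.sqrt (μ i))⁻¹) = fun _ => 1 := by
        ext i; exact mul_inv_cancel₀ (Real.sqrt_pos.2 (hμ i)).ne'
      rw [this, Matrix.diagonal_one, Matrix.one_mul]
    rw [Matrix.mul_assoc, hF, this, ← Matrix.mul_assoc]; exact hχ
  have hJt : Jᵀ = J := Matrix.diagonal_transpose _
  have hdec : (Fh - J * F) * Y = (Mh * Vhᵀ * V * Ms - J) * (F * Y)
      + Mh * ((Vh - V * J)ᵀ * (E * Y)) + Mh * (J * (Vᵀ * E * Y)) := by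
    have e : Fh = Mh * Vhᵀ * V * Ms * F + Mh * Vhᵀ * E := by
      rw [hFh, Matrix.mul_add]
      conv_lhs => rw [hχF]
      simp only [Matrix.mul_assoc]
    rw [e, Matrix.transpose_sub, Matrix.transpose_mul, hJt]
    simp only [Matrix.sub_mul, Matrix.add_mul, Matrix.mul_sub, Matrix.mul_assoc]
    abel
  have hd : ∀ j, ((Real.sqrt (μh j))⁻¹) ^ 2 ≤ 2 / g := by
    intro j
    have h0 : 0 < μh j := by linarith [hμh j]
    rw [inv_pow, Real.sq_sqrt h0.le, inv_eq_one_div, div_le_div_iff₀ h0 hg]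
    linarith [hμh j]
  have hg2 : 0 ≤ 2 / g := by positivity
  have h1 : n2 ((Mh * Vhᵀ * V * Ms - J) * (F * Y)) ≤ b * n2 (F * Y) :=
    (n2_mul_le _ _).trans (mul_le_mul_of_nonneg_right hb (n2_nonneg _))
  have h2 : n2 (Mh * ((Vh - V * J)ᵀ * (E * Y))) ≤ 2 / g * (a * n2 (E * Y)) := by
    refine (n2_diagonal_mul_le _ _ hd _).trans (mul_le_mul_of_nonneg_left ?_ hg2)
    refine (n2_mul_le _ _).trans (mul_le_mul_of_nonneg_right ?_ (n2_nonneg _))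
    rw [n2_transpose]; exact ha
  have h3 : n2 (Mh * (J * (Vᵀ * E * Y))) ≤ 2 / g * n2 (Vᵀ * E * Y) := by
    refine (n2_diagonal_mul_le _ _ hd _).trans (mul_le_mul_of_nonneg_left ?_ hg2)
    refine (n2_diagonal_mul_le _ 1 (fun j => (sgnVec_sq V Vh j).le) _).trans (by rw [one_mul])
  rw [hdec]
  refine (n2_add3_le _ _ _).trans ?_
  linarith

/-- The constant in the factor error bound. -/
noncomputable def Kc (r : ℕ) (γ κ : ℝ) : ℝ :=
  3 * (r * (r * ((2 * κ / γ + 4) * (4 / γ ^ 2))) + 2 / γ * (r * (2 * (4 / γ ^ 2))) + 2 / γ)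

lemma Kc_pos (r : ℕ) {γ κ : ℝ} (hγ : 0 < γ) (hκ : 0 ≤ κ) : 0 < Kc r γ κ := by
  unfold Kc; positivity

/-- Deterministic bound on the (contracted) factor estimation error. -/
lemma factor_bound {m r : ℕ} {n p : Type*} [Fintype n] [Fintype p] [DecidableEq n]
    (hm : 0 < m)
    {V Vh : Matrix (Fin m) (Fin r) ℝ} (hV : Vᵀ * V = 1) (hVh : Vhᵀ * Vh = 1)
    {μ μh : Fin r → ℝ} (ha : Antitone μ) (hah : Antitone μh)
    {Gh : Matrix (Fin m) (Fin m) ℝ} (hG : Ghᵀ = Gh)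
    (hE : Gh * Vh = Vh * Matrix.diagonal μh)
    (hTop : ∀ (ν' : ℝ) (x : Fin m → ℝ), x ≠ 0 → Gh.mulVec x = ν' • x → Vhᵀ.mulVec x = 0 →
      ∀ j, ν' ≤ μh j)
    {γ κ : ℝ} (hγ : 0 < γ) (hκ : 0 ≤ κ) (hgap : ∀ i j, i ≠ j → γ * m ≤ |μ i - μ j|)
    (hlow : ∀ j, γ * m ≤ μ j) (hup : ∀ j, μ j ≤ κ * m) {e : ℝ}
    (he : n2 (Gh - V * Matrix.diagonal μ * Vᵀ) ≤ e * (m : ℝ) ^ 2) (heγ : e ≤ γ ^ 2 / 4)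
    {χ E : Matrix (Fin m) n ℝ} (hχ : χ = V * Vᵀ * χ) {F Fh : Matrix (Fin r) n ℝ}
    (hF : F = Matrix.diagonal (fun j => (Real.sqrt (μ j))⁻¹) * Vᵀ * χ)
    (hFh : Fh = Matrix.diagonal (fun j => (Real.sqrt (μh j))⁻¹) * Vhᵀ * (χ + E))
    (Y : Matrix n p ℝ) :
    n2 ((Fh - Matrix.diagonal (sgnVec V Vh) * F) * Y) ≤
      Kc r γ κ * (e + (m : ℝ)⁻¹) * (n2 (F * Y) + n2 (E * Y) / m + n2 (Vᵀ * E * Y)) := by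
  have hm' : (0 : ℝ) < m := by exact_mod_cast hm
  have he0 : 0 ≤ e := by
    have := n2_nonneg (Gh - V * Matrix.diagonal μ * Vᵀ)
    exact nonneg_of_mul_nonneg_left (this.trans he) (by positivity)
  have hδ : 0 ≤ Real.sqrt e * m := by positivity
  have hδ2 : (Real.sqrt e * m) ^ 2 = e * (m : ℝ) ^ 2 := by rw [mul_pow, Real.sq_sqrt he0]
  have hse : Real.sqrt e ≤ γ / 2 := by
    rw [Real.sqrt_le_left (by positivity)]; linarith [heγ, (by ring : (γ / 2) ^ 2 = γ ^ 2 / 4)]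
  obtain ⟨h1, h2, h3⟩ := perturb hV hVh ha hah hG hE hTop (g := γ * m) (h := κ * m)
    (δ := Real.sqrt e * m) (η := 4 / γ ^ 2 * e) (by positivity) hgap hlow hup hδ
    (by nlinarith) (by rw [hδ2]; field_simp) (by rw [hδ2]; exact he)
  have h4 := decomp_bound (g := γ * m) (by positivity)
    (fun j => lt_of_lt_of_le (by positivity) (hlow j)) h1 hχ hF hFh h2 h3 Y
  refine h4.trans ?_
  have hx := n2_nonneg (F * Y)
  have hy := n2_nonneg (E * Y)
  have hz := n2_nonneg (Vᵀ * E * Y)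
  set x := n2 (F * Y)
  set y := n2 (E * Y)
  set z := n2 (Vᵀ * E * Y)
  have e1 : 2 * (κ * m) / (γ * m) = 2 * κ / γ := by field_simp
  rw [e1]
  have e2 : 3 * (r * (r * ((2 * κ / γ + 4) * (4 / γ ^ 2 * e))) * x
        + 2 / (γ * m) * (r * (2 * (4 / γ ^ 2 * e)) * y) + 2 / (γ * m) * z)
      = 3 * ((r * (r * ((2 * κ / γ + 4) * (4 / γ ^ 2)))) * (e * x)
        + (2 / γ * (r * (2 * (4 / γ ^ 2)))) * (e * (y / m)) + 2 / γ * ((m : ℝ)⁻¹ * z)) := by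
    field_simp
  rw [e2]
  unfold Kc
  have hA : 0 ≤ (r * (r * ((2 * κ / γ + 4) * (4 / γ ^ 2))) : ℝ) := by positivity
  have hB : 0 ≤ (2 / γ * (r * (2 * (4 / γ ^ 2))) : ℝ) := by positivity
  have hC : 0 ≤ 2 / γ := by positivity
  set A := (r * (r * ((2 * κ / γ + 4) * (4 / γ ^ 2))) : ℝ)
  set B := (2 / γ * (r * (2 * (4 / γ ^ 2))) : ℝ)
  set C := 2 / γ
  have hy' : 0 ≤ y / m := by positivity
  have hmi : 0 ≤ (m : ℝ)⁻¹ := by positivity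
  set w := y / m
  set i := (m : ℝ)⁻¹
  have q1 : e * x ≤ (e + i) * (x + w + z) :=
    mul_le_mul (by linarith) (by linarith) hx (by linarith)
  have q2 : e * w ≤ (e + i) * (x + w + z) :=
    mul_le_mul (by linarith) (by linarith) hy' (by linarith)
  have q3 : i * z ≤ (e + i) * (x + w + z) :=
    mul_le_mul (by linarith) (by linarith) hz (by linarith)
  calc 3 * (A * (e * x) + B * (e * w) + C * (i * z))
      ≤ 3 * (A * ((e + i) * (x + w + z)) + B * ((e + i) * (x + w + z))
        + C * ((e + i) * (x + w + z))) := by gcongr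
    _ = _ := by ring

/-! ### Moments -/

section Prob
variable {Ω : Type*} [MeasurableSpace Ω] {P : Measure Ω}

lemma quad_integral {a n k : Type*} [Fintype a] [Fintype n] [Fintype k]
    (Y : Ω → Matrix a n ℝ) (G : Matrix a a ℝ)
    (h : ∀ i j, Integrable (fun ω => (Y ω * (Y ω)ᵀ) i j) P ∧
      ∫ ω, (Y ω * (Y ω)ᵀ) i j ∂P = G i j) (B : Matrix k a ℝ) :
    Integrable (fun ω => n2 (B * Y ω)) P ∧ ∫ ω, n2 (B * Y ω) ∂P = (B * G * Bᵀ).trace := by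
  have e : ∀ M : Matrix a a ℝ, (B * M * Bᵀ).trace = ∑ l, ∑ j, ∑ i, B l i * M i j * B l j := by
    intro M
    simp only [Matrix.trace, Matrix.diag, Matrix.mul_apply, Matrix.transpose_apply, Finset.sum_mul]
  have e1 : (fun ω => n2 (B * Y ω)) = fun ω => ∑ l, ∑ j, ∑ i, B l i * (Y ω * (Y ω)ᵀ) i j * B l j := by
    ext ω
    rw [n2_eq_trace, ← e]
    simp only [Matrix.transpose_mul, Matrix.mul_assoc]
  have hi : ∀ l j i, Integrable (fun ω => B l i * (Y ω * (Y ω)ᵀ) i j * B l j) P := fun l j i =>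
    ((h i j).1.const_mul _).mul_const _
  rw [e1]
  constructor
  · exact integrable_finsetSum _ fun l _ => integrable_finsetSum _ fun j _ =>
      integrable_finsetSum _ fun i _ => hi l j i
  · rw [e, integral_finsetSum _ fun l _ => integrable_finsetSum _ fun j _ =>
      integrable_finsetSum _ fun i _ => hi l j i]
    refine Finset.sum_congr rfl fun l _ => ?_
    rw [integral_finsetSum _ fun j _ => integrable_finsetSum _ fun i _ => hi l j i]
    refine Finset.sum_congr rfl fun j _ => ?_
    rw [integral_finsetSum _ fun i _ => hi l j i]
    refine Finset.sum_congr rfl fun i _ => ?_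
    rw [integral_mul_const, integral_const_mul, (h i j).2]

lemma psd_frob {m : ℕ} {G : Matrix (Fin m) (Fin m) ℝ} (hs : Gᵀ = G)
    (h0 : ∀ x : Fin m → ℝ, 0 ≤ x ⬝ᵥ G.mulVec x) {l : ℝ} (hl : 0 < l)
    (h1 : ∀ x : Fin m → ℝ, x ⬝ᵥ G.mulVec x ≤ l * (x ⬝ᵥ x)) : n2 G ≤ m * l ^ 2 := by
  have key : ∀ x : Fin m → ℝ, G.mulVec x ⬝ᵥ G.mulVec x ≤ l ^ 2 * (x ⬝ᵥ x) := by
    intro x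
    have a1 := h0 (l • x - G.mulVec x)
    have a2 := h1 (G.mulVec x)
    have a3 := h1 x
    rw [Matrix.mulVec_sub, Matrix.mulVec_smul, sub_dotProduct, dotProduct_sub, dotProduct_sub,
      smul_dotProduct, dotProduct_smul, smul_dotProduct, dotProduct_smul] at a1
    have a4 : x ⬝ᵥ G.mulVec (G.mulVec x) = G.mulVec x ⬝ᵥ G.mulVec x := by
      rw [Matrix.dotProduct_mulVec, ← Matrix.mulVec_transpose, hs]
    simp only [smul_eq_mul, a4] at a1
    have a5 : l * (G.mulVec x ⬝ᵥ G.mulVec x) ≤ l * (l ^ 2 * (x ⬝ᵥ x)) := by nlinarith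
    exact le_of_mul_le_mul_left a5 hl
  rw [← n2_transpose]
  unfold n2
  have : ∀ j ∈ (Finset.univ : Finset (Fin m)), ∑ i, (Gᵀ j i) ^ 2 ≤ l ^ 2 := by
    intro j _
    have := key (Pi.single j 1)
    have h1 : (Pi.single j 1 : Fin m → ℝ) ⬝ᵥ Pi.single j 1 = 1 := by simp
    rw [h1, mul_one] at this
    simpa [dotProduct, ← pow_two] using this
  refine (Finset.sum_le_card_nsmul _ _ _ this).trans ?_
  simp

/-- Markov's inequality in the form needed. -/
lemma markov_lt [IsFiniteMeasure P] {f : Ω → ℝ} (hf0 : ∀ ω, 0 ≤ f ω) (hf : Integrable f P) {B C : ℝ}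
    (hB : ∫ ω, f ω ∂P ≤ B) (hC : 0 < C) : P {ω | C < f ω} ≤ ENNReal.ofReal (B / C) := by
  have h := mul_meas_ge_le_integral_of_nonneg (μ := P) (ae_of_all _ hf0) hf C
  have h2 : P.real {ω | C ≤ f ω} ≤ B / C := by
    rw [le_div_iff₀ hC]; linarith
  calc P {ω | C < f ω} ≤ P {ω | C ≤ f ω} := measure_mono fun ω (h : C < f ω) => h.le
    _ = ENNReal.ofReal (P.real {ω | C ≤ f ω}) := (ofReal_measureReal).symm
    _ ≤ _ := ENNReal.ofReal_le_ofReal h2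

lemma x_moment [IsProbabilityMeasure P] {a b : Type*} [Fintype a] [Fintype b] {X : Ω → Matrix a b ℝ}
    {M : ℝ} (h : Integrable (fun ω => (frobNorm (X ω)) ^ 8) P ∧
      ∫ ω, (frobNorm (X ω)) ^ 8 ∂P ≤ M) :
    Integrable (fun ω => n2 (X ω)) P ∧ ∫ ω, n2 (X ω) ∂P ≤ 1 + M := by
  have hle : ∀ ω, n2 (X ω) ≤ 1 + (frobNorm (X ω)) ^ 8 := by
    intro ω
    have e : (frobNorm (X ω)) ^ 8 = (n2 (X ω)) ^ 4 := by rw [← frobNorm_sq]; ring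
    rw [e]
    have := n2_nonneg (X ω)
    nlinarith [sq_nonneg (n2 (X ω) ^ 2 - 1), sq_nonneg (n2 (X ω) - 1), sq_nonneg (n2 (X ω) ^ 2)]
  have hint : Integrable (fun ω => 1 + (frobNorm (X ω)) ^ 8) P := (integrable_const 1).add h.1
  have hmeas : AEStronglyMeasurable (fun ω => n2 (X ω)) P := by
    have : (fun ω => n2 (X ω)) = fun ω => Real.sqrt (Real.sqrt ((frobNorm (X ω)) ^ 8)) := by
      ext ω
      have e : (frobNorm (X ω)) ^ 8 = ((n2 (X ω)) ^ 2) ^ 2 := by rw [← frobNorm_sq]; ring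
      rw [e, Real.sqrt_sq (sq_nonneg _), Real.sqrt_sq (n2_nonneg _)]
    rw [this]
    exact (h.1.aestronglyMeasurable.aemeasurable.sqrt.sqrt).aestronglyMeasurable
  have hi : Integrable (fun ω => n2 (X ω)) P := by
    refine hint.mono' hmeas (ae_of_all _ fun ω => ?_)
    rw [Real.norm_of_nonneg (n2_nonneg _)]; exact hle ω
  refine ⟨hi, (integral_mono hi hint hle).trans ?_⟩
  rw [integral_add (integrable_const 1) h.1]
  simpa using h.2

lemma n2_measurable {a b : Type*} [Fintype a] [Fintype b] :
    Measurable (fun x : a → b → ℝ => n2 (Matrix.of x)) := by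
  unfold n2
  simp only [Matrix.of_apply]
  fun_prop

lemma n2_mul_measurable {a b c : Type*} [Fintype a] [Fintype b] [Fintype c] (B : Matrix c a ℝ) :
    Measurable (fun x : a → b → ℝ => n2 (B * Matrix.of x)) := by
  unfold n2
  simp only [Matrix.mul_apply, Matrix.of_apply]
  fun_prop

/-- Product moment of independent pieces. -/
lemma indep_moment {a b c d k Z : Type*} [Fintype a] [Fintype b] [Fintype c] [Fintype d] [Fintype k]
    [MeasurableSpace Z]
    {X : Ω → a → b → ℝ} {ν : Ω → Z} {E : Ω → c → d → ℝ}
    (hind : IndepFun (fun ω => (X ω, ν ω)) E P) (B : Matrix k c ℝ)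
    (hX : Integrable (fun ω => n2 (Matrix.of (X ω))) P)
    (hE : Integrable (fun ω => n2 (B * Matrix.of (E ω))) P) :
    Integrable (fun ω => n2 (Matrix.of (X ω)) * n2 (B * Matrix.of (E ω))) P ∧
    ∫ ω, n2 (Matrix.of (X ω)) * n2 (B * Matrix.of (E ω)) ∂P =
      (∫ ω, n2 (Matrix.of (X ω)) ∂P) * ∫ ω, n2 (B * Matrix.of (E ω)) ∂P := by
  have h := hind.comp (φ := fun p : (a → b → ℝ) × Z => n2 (Matrix.of p.1))
    (n2_measurable.comp measurable_fst) (n2_mul_measurable B)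
  have h' : IndepFun (fun ω => n2 (Matrix.of (X ω))) (fun ω => n2 (B * Matrix.of (E ω))) P := h
  exact ⟨h'.integrable_mul hX hE,
    h'.integral_fun_mul_eq_mul_integral hX.aestronglyMeasurable hE.aestronglyMeasurable⟩

/-- The common component lies in the span of the loadings. -/
lemma common_span {m r : ℕ} {n : Type*} [Fintype n] {V : Matrix (Fin m) (Fin r) ℝ}
    (hV : Vᵀ * V = 1) {μ : Fin r → ℝ} {χ : Ω → Matrix (Fin m) n ℝ}
    (h : ∀ i j, Integrable (fun ω => (χ ω * (χ ω)ᵀ) i j) P ∧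
      ∫ ω, (χ ω * (χ ω)ᵀ) i j ∂P = (V * Matrix.diagonal μ * Vᵀ) i j) :
    ∀ᵐ ω ∂P, χ ω = V * Vᵀ * χ ω := by
  obtain ⟨hi, h0⟩ := quad_integral χ _ h (1 - V * Vᵀ)
  have : (1 - V * Vᵀ) * (V * Matrix.diagonal μ * Vᵀ) = 0 := by
    rw [Matrix.sub_mul, Matrix.one_mul]
    have : V * Vᵀ * (V * Matrix.diagonal μ * Vᵀ) = V * (Vᵀ * V) * Matrix.diagonal μ * Vᵀ := by
      simp only [Matrix.mul_assoc]
    rw [this, hV, Matrix.mul_one, sub_self]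
  rw [this, Matrix.zero_mul, Matrix.trace_zero,
    integral_eq_zero_iff_of_nonneg (fun ω => n2_nonneg _) hi] at h0
  filter_upwards [h0] with ω hω
  have := n2_eq_zero hω
  rw [Matrix.sub_mul, Matrix.one_mul, sub_eq_zero] at this
  exact this

end Prob

section Prob2
variable {Ω : Type*} [MeasurableSpace Ω] {P : Measure Ω}

lemma F_moment {m r : ℕ} {n : Type*} [Fintype n] {V : Matrix (Fin m) (Fin r) ℝ}
    (hV : Vᵀ * V = 1) {μ : Fin r → ℝ} (hμ : ∀ j, 0 < μ j) {χ : Ω → Matrix (Fin m) n ℝ}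
    (h : ∀ i j, Integrable (fun ω => (χ ω * (χ ω)ᵀ) i j) P ∧
      ∫ ω, (χ ω * (χ ω)ᵀ) i j ∂P = (V * Matrix.diagonal μ * Vᵀ) i j)
    {F : Ω → Matrix (Fin r) n ℝ}
    (hF : ∀ ω, F ω = Matrix.diagonal (fun j => (Real.sqrt (μ j))⁻¹) * Vᵀ * χ ω) :
    Integrable (fun ω => n2 (F ω)) P ∧ ∫ ω, n2 (F ω) ∂P = r := by
  have := quad_integral χ _ h (Matrix.diagonal (fun j => (Real.sqrt (μ j))⁻¹) * Vᵀ)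
  simp only [← hF] at this
  refine ⟨this.1, this.2.trans ?_⟩
  have e : Matrix.diagonal (fun j => (Real.sqrt (μ j))⁻¹) * Vᵀ * (V * Matrix.diagonal μ * Vᵀ) *
      (Matrix.diagonal (fun j => (Real.sqrt (μ j))⁻¹) * Vᵀ)ᵀ = 1 := by
    rw [Matrix.transpose_mul, Matrix.transpose_transpose, Matrix.diagonal_transpose]
    have : Matrix.diagonal (fun j => (Real.sqrt (μ j))⁻¹) * Vᵀ * (V * Matrix.diagonal μ * Vᵀ) *
      (V * Matrix.diagonal (fun j => (Real.sqrt (μ j))⁻¹)) =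
      Matrix.diagonal (fun j => (Real.sqrt (μ j))⁻¹) * (Vᵀ * V) * Matrix.diagonal μ * (Vᵀ * V) *
      Matrix.diagonal (fun j => (Real.sqrt (μ j))⁻¹) := by simp only [Matrix.mul_assoc]
    rw [this, hV, Matrix.mul_one, Matrix.mul_one, Matrix.diagonal_mul_diagonal,
      Matrix.diagonal_mul_diagonal, ← Matrix.diagonal_one]
    congr 1
    ext j
    have h1 := Real.sqrt_pos.2 (hμ j)
    have h2 := Real.mul_self_sqrt (hμ j).le
    field_simp
    nlinarith
  rw [e]; simp

lemma E_moment {m r : ℕ} {n : Type*} [Fintype n] {V : Matrix (Fin m) (Fin r) ℝ}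
    (hV : Vᵀ * V = 1) {E : Ω → Matrix (Fin m) n ℝ} {G : Matrix (Fin m) (Fin m) ℝ}
    (h : ∀ i j, Integrable (fun ω => (E ω * (E ω)ᵀ) i j) P ∧
      ∫ ω, (E ω * (E ω)ᵀ) i j ∂P = G i j) {l : ℝ}
    (hl : ∀ x : Fin m → ℝ, x ⬝ᵥ G.mulVec x ≤ l * (x ⬝ᵥ x)) :
    (Integrable (fun ω => n2 (E ω)) P ∧ ∫ ω, n2 (E ω) ∂P ≤ m * l) ∧
    (Integrable (fun ω => n2 (Vᵀ * E ω)) P ∧ ∫ ω, n2 (Vᵀ * E ω) ∂P ≤ r * l) := by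
  have gen : ∀ {k : ℕ} (B : Matrix (Fin m) (Fin k) ℝ), Bᵀ * B = 1 →
      (Integrable (fun ω => n2 (Bᵀ * E ω)) P ∧ ∫ ω, n2 (Bᵀ * E ω) ∂P ≤ k * l) := by
    intro k B hB
    obtain ⟨h1, h2⟩ := quad_integral E _ h Bᵀ
    refine ⟨h1, ?_⟩
    rw [h2, Matrix.transpose_transpose]
    have : ∀ j ∈ (Finset.univ : Finset (Fin k)), (Bᵀ * G * B) j j ≤ l := by
      intro j _
      have h3 := hl (fun i => B i j)
      have h4 : (fun i => B i j) ⬝ᵥ (fun i => B i j) = 1 := by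
        have := congrFun (congrFun hB j) j
        simpa [Matrix.mul_apply, dotProduct] using this
      rw [h4, mul_one] at h3
      convert h3 using 1
      rw [Matrix.mul_assoc]; rfl
    refine (Finset.sum_le_card_nsmul _ _ _ this).trans ?_
    simp
  refine ⟨?_, gen V hV⟩
  have := gen (1 : Matrix (Fin m) (Fin m) ℝ) (by simp)
  simpa using this

lemma cov_psd {m : ℕ} {n : Type*} [Fintype n] {E : Ω → Matrix (Fin m) n ℝ}
    {G : Matrix (Fin m) (Fin m) ℝ}
    (h : ∀ i j, Integrable (fun ω => (E ω * (E ω)ᵀ) i j) P ∧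
      ∫ ω, (E ω * (E ω)ᵀ) i j ∂P = G i j) :
    Gᵀ = G ∧ ∀ x : Fin m → ℝ, 0 ≤ x ⬝ᵥ G.mulVec x := by
  constructor
  · ext i j
    rw [Matrix.transpose_apply, ← (h i j).2, ← (h j i).2]
    refine integral_congr_ae (ae_of_all _ fun ω => ?_)
    simp only [Matrix.mul_apply, Matrix.transpose_apply]
    exact Finset.sum_congr rfl fun k _ => mul_comm _ _
  · intro x
    have := (quad_integral E _ h (Matrix.of fun (_ : Fin 1) i => x i)).2
    have h0 : 0 ≤ ∫ ω, n2 ((Matrix.of fun (_ : Fin 1) i => x i) * E ω) ∂P :=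
      integral_nonneg fun ω => n2_nonneg _
    rw [this, Matrix.mul_assoc] at h0
    simpa [Matrix.trace, Matrix.mul_apply, dotProduct, Matrix.mulVec] using h0

lemma cov_sum {m r : ℕ} {n : Type*} [Fintype n] {V : Matrix (Fin m) (Fin r) ℝ}
    (hV : Vᵀ * V = 1) {μ : Fin r → ℝ} (hμ : ∀ j, 0 < μ j) {χ E W : Ω → Matrix (Fin m) n ℝ}
    (hW : ∀ ω, W ω = χ ω + E ω)
    (h : ∀ i j, Integrable (fun ω => (χ ω * (χ ω)ᵀ) i j) P ∧
      ∫ ω, (χ ω * (χ ω)ᵀ) i j ∂P = (V * Matrix.diagonal μ * Vᵀ) i j)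
    {F : Ω → Matrix (Fin r) n ℝ}
    (hF : ∀ ω, F ω = Matrix.diagonal (fun j => (Real.sqrt (μ j))⁻¹) * Vᵀ * χ ω)
    (hEF : ∀ i j, Integrable (fun ω => (E ω * (F ω)ᵀ) i j) P ∧
      ∫ ω, (E ω * (F ω)ᵀ) i j ∂P = 0)
    {GE GW : Matrix (Fin m) (Fin m) ℝ}
    (hE : ∀ i j, Integrable (fun ω => (E ω * (E ω)ᵀ) i j) P ∧
      ∫ ω, (E ω * (E ω)ᵀ) i j ∂P = GE i j)
    (hGW : ∀ i j, Integrable (fun ω => (W ω * (W ω)ᵀ) i j) P ∧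
      ∫ ω, (W ω * (W ω)ᵀ) i j ∂P = GW i j) :
    GW = V * Matrix.diagonal μ * Vᵀ + GE := by
  have hsp := common_span hV h
  set U := V * Matrix.diagonal (fun j => Real.sqrt (μ j)) with hU
  have hUF : ∀ᵐ ω ∂P, χ ω = U * F ω := by
    filter_upwards [hsp] with ω hω
    have e : Matrix.diagonal (fun j => Real.sqrt (μ j)) *
        (Matrix.diagonal (fun j => (Real.sqrt (μ j))⁻¹) * Vᵀ * χ ω) = Vᵀ * χ ω := by
      rw [← Matrix.mul_assoc, ← Matrix.mul_assoc, Matrix.diagonal_mul_diagonal]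
      have : (fun i => Real.sqrt (μ i) * (Real.sqrt (μ i))⁻¹) = fun _ => 1 := by
        ext i; exact mul_inv_cancel₀ (Real.sqrt_pos.2 (hμ i)).ne'
      rw [this, Matrix.diagonal_one, Matrix.one_mul]
    rw [hU, Matrix.mul_assoc, hF, e, ← Matrix.mul_assoc]; exact hω
  have hcr : ∀ i j, Integrable (fun ω => ∑ k, (E ω * (F ω)ᵀ) i k * U j k) P ∧
      ∫ ω, ∑ k, (E ω * (F ω)ᵀ) i k * U j k ∂P = 0 := by
    intro i j
    have hi : ∀ k ∈ (Finset.univ : Finset (Fin r)),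
        Integrable (fun ω => (E ω * (F ω)ᵀ) i k * U j k) P := fun k _ => (hEF i k).1.mul_const _
    refine ⟨integrable_finsetSum _ hi, ?_⟩
    rw [integral_finsetSum _ hi]
    refine Finset.sum_eq_zero fun k _ => ?_
    rw [integral_mul_const, (hEF i k).2, zero_mul]
  ext i j
  rw [← (hGW i j).2, Matrix.add_apply, ← (h i j).2, ← (hE i j).2]
  have e : ∀ᵐ ω ∂P, (W ω * (W ω)ᵀ) i j = ((χ ω * (χ ω)ᵀ) i j + (E ω * (E ω)ᵀ) i j) +
      ((∑ k, (E ω * (F ω)ᵀ) i k * U j k) + ∑ k, (E ω * (F ω)ᵀ) j k * U i k) := by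
    filter_upwards [hUF] with ω hω
    have e1 : ∀ a b, (E ω * (χ ω)ᵀ) a b = ∑ k, (E ω * (F ω)ᵀ) a k * U b k := by
      intro a b
      conv_lhs => rw [hω, Matrix.transpose_mul, ← Matrix.mul_assoc]
      rfl
    have e2 : (χ ω * (E ω)ᵀ) i j = (E ω * (χ ω)ᵀ) j i := by
      simp only [Matrix.mul_apply, Matrix.transpose_apply]
      exact Finset.sum_congr rfl fun k _ => mul_comm _ _
    rw [← e1, ← e1, ← e2, hW, Matrix.transpose_add, Matrix.add_mul, Matrix.mul_add, Matrix.mul_add]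
    simp only [Matrix.add_apply]
    ring
  have hi1 : Integrable (fun ω => (χ ω * (χ ω)ᵀ) i j + (E ω * (E ω)ᵀ) i j) P :=
    (h i j).1.add (hE i j).1
  have hi2 : Integrable (fun ω => (∑ k, (E ω * (F ω)ᵀ) i k * U j k) +
      ∑ k, (E ω * (F ω)ᵀ) j k * U i k) P := (hcr i j).1.add (hcr j i).1
  rw [integral_congr_ae e, integral_add hi1 hi2,
    integral_add (h i j).1 (hE i j).1, integral_add (hcr i j).1 (hcr j i).1, (hcr i j).2,
    (hcr j i).2]
  ring

/-- Control of the covariance estimation error. -/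
lemma cov_err [IsProbabilityMeasure P] {m : ℕ} (hm : 0 < m) {T : ℕ} (hT : 0 < T)
    {G0 GE GW : Matrix (Fin m) (Fin m) ℝ}
    {Gh : Ω → Matrix (Fin m) (Fin m) ℝ} (hsum : GW = G0 + GE) {l R : ℝ} (hGE : n2 GE ≤ m * l ^ 2)
    (hA6 : ∀ i j,
      Integrable (fun ω => (Gh ω i j - GW i j) ^ 2) P ∧
      (T : ℝ) * ∫ ω, (Gh ω i j - GW i j) ^ 2 ∂P ≤ R) :
    ∃ e : Ω → ℝ, (∀ ω, 0 ≤ e ω) ∧ Integrable e P ∧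
      ∫ ω, e ω ∂P ≤ 2 * (|R| + l ^ 2) * (min (m : ℝ) T)⁻¹ ∧
      ∀ ω, n2 (Gh ω - G0) ≤ e ω * (m : ℝ) ^ 2 := by
  have hm' : (0 : ℝ) < m := by exact_mod_cast hm
  have hT' : (0 : ℝ) < T := by exact_mod_cast hT
  have hi : Integrable (fun ω => n2 (Gh ω - GW)) P := by
    unfold n2
    exact integrable_finsetSum _ fun i _ => integrable_finsetSum _ fun j _ => (hA6 i j).1
  have hI : ∫ ω, n2 (Gh ω - GW) ∂P ≤ m * (m * (|R| / T)) := by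
    unfold n2
    have hi' : ∀ i j, Integrable (fun ω => ((Gh ω - GW) i j) ^ 2) P := fun i j => (hA6 i j).1
    rw [integral_finsetSum _ fun i _ => integrable_finsetSum _ fun j _ => hi' i j]
    have : ∀ i ∈ (Finset.univ : Finset (Fin m)), ∫ ω, ∑ j, ((Gh ω - GW) i j) ^ 2 ∂P
        ≤ m * (|R| / T) := by
      intro i _
      rw [integral_finsetSum _ fun j _ => hi' i j]
      have : ∀ j ∈ (Finset.univ : Finset (Fin m)), ∫ ω, ((Gh ω - GW) i j) ^ 2 ∂P ≤ |R| / T := by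
        intro j _
        rw [le_div_iff₀ hT', mul_comm]
        exact (hA6 i j).2.trans (le_abs_self R)
      refine (Finset.sum_le_card_nsmul _ _ _ this).trans ?_
      simp
    refine (Finset.sum_le_card_nsmul _ _ _ this).trans ?_
    simp
  refine ⟨fun ω => n2 (Gh ω - GW) * (2 / (m : ℝ) ^ 2) + 2 * l ^ 2 / m, fun ω => ?_,
    (hi.mul_const _).add (integrable_const _), ?_, fun ω => ?_⟩
  · have := n2_nonneg (Gh ω - GW)
    positivity
  · rw [integral_add (hi.mul_const _) (integrable_const _), integral_mul_const]
    simp only [integral_const, probReal_univ, smul_eq_mul, one_mul]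
    have h1 : (∫ ω, n2 (Gh ω - GW) ∂P) * (2 / (m : ℝ) ^ 2) ≤ 2 * |R| * (T : ℝ)⁻¹ := by
      calc _ ≤ (m * (m * (|R| / T))) * (2 / (m : ℝ) ^ 2) :=
            mul_le_mul_of_nonneg_right hI (by positivity)
        _ = _ := by field_simp
    have h2 : 2 * |R| * (T : ℝ)⁻¹ ≤ 2 * |R| * (min (m : ℝ) T)⁻¹ := by
      have : min (m : ℝ) T ≤ T := min_le_right _ _
      have : 0 < min (m : ℝ) T := lt_min hm' hT'
      gcongr
    have h3 : 2 * l ^ 2 / m ≤ 2 * l ^ 2 * (min (m : ℝ) T)⁻¹ := by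
      rw [div_eq_mul_inv]
      have : min (m : ℝ) T ≤ m := min_le_left _ _
      have : 0 < min (m : ℝ) T := lt_min hm' hT'
      gcongr
    linarith
  · have : Gh ω - G0 = (Gh ω - GW) + GE := by rw [hsum]; abel
    rw [this]
    refine (n2_add_le _ _).trans ?_
    have e : (n2 (Gh ω - GW) * (2 / (m : ℝ) ^ 2) + 2 * l ^ 2 / m) * (m : ℝ) ^ 2
      = 2 * (n2 (Gh ω - GW) + m * l ^ 2) := by field_simp
    rw [e]; linarith

end Prob2

/-! ### Design matrix facts -/

lemma n2_design {N r : ℕ} (F : Matrix (Fin r) (Fin N × Fin N) ℝ) (y : Fin N → ℝ)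
    (X : Matrix (Fin N) (Fin r ⊕ Fin N ⊕ Fin N) ℝ)
    (hX : X = Matrix.of fun i c =>
      Sum.elim (fun k => ∑ j, F k (i, j) * y j)
        (Sum.elim (fun i' => if i = i' then y i else 0)
          (fun i' => if i = i' then (1 : ℝ) else 0)) c) :
    n2 (F * ymat y) + ∑ i, y i ^ 2 ≤ n2 X := by
  have : n2 X = ∑ i, ∑ k, ((F * ymat y) k i) ^ 2 + ∑ i, y i ^ 2 + N := by
    rw [hX]
    unfold n2
    simp only [Matrix.of_apply, Fintype.sum_sum_type, Sum.elim_inl, Sum.elim_inr, mul_ymat,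
      Finset.sum_add_distrib, ite_pow]
    simp [add_assoc]
  have h2 : n2 (F * ymat y) = ∑ i, ∑ k, ((F * ymat y) k i) ^ 2 := by
    unfold n2; exact Finset.sum_comm
  rw [this, h2]
  have : (0 : ℝ) ≤ N := Nat.cast_nonneg _
  linarith

lemma n2_design_hat {N r : ℕ} (F Fh : Matrix (Fin r) (Fin N × Fin N) ℝ) (y : Fin N → ℝ)
    (s : Fin r → ℝ) (hs : ∀ k, s k ^ 2 = 1)
    (X Xh : Matrix (Fin N) (Fin r ⊕ Fin N ⊕ Fin N) ℝ)
    (hX : X = Matrix.of fun i c =>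
      Sum.elim (fun k => ∑ j, F k (i, j) * y j)
        (Sum.elim (fun i' => if i = i' then y i else 0)
          (fun i' => if i = i' then (1 : ℝ) else 0)) c)
    (hXh : Xh = Matrix.of fun i c =>
      Sum.elim (fun k => ∑ j, Fh k (i, j) * y j)
        (Sum.elim (fun i' => if i = i' then y i else 0)
          (fun i' => if i = i' then (1 : ℝ) else 0)) c) :
    n2 Xh ≤ 2 * n2 X + 2 * n2 ((Fh - Matrix.diagonal s * F) * ymat y) := by
  have h2 : n2 ((Fh - Matrix.diagonal s * F) * ymat y) =
      ∑ i, ∑ k, (((Fh - Matrix.diagonal s * F) * ymat y) k i) ^ 2 := by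
    unfold n2; exact Finset.sum_comm
  rw [h2]
  unfold n2
  rw [Finset.mul_sum, Finset.mul_sum, ← Finset.sum_add_distrib]
  refine Finset.sum_le_sum fun i _ => ?_
  have hin : ∀ k, Xh i (Sum.inl k) = ((Fh - Matrix.diagonal s * F) * ymat y) k i
      + s k * X i (Sum.inl k) := by
    intro k
    rw [mul_ymat, hX, hXh]
    simp only [Matrix.of_apply, Sum.elim_inl, Matrix.sub_apply, Matrix.diagonal_mul]
    rw [Finset.mul_sum, ← Finset.sum_add_distrib]
    exact Finset.sum_congr rfl fun j _ => by ring
  have hinr : ∀ c, Xh i (Sum.inr c) = X i (Sum.inr c) := by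
    intro c; rw [hX, hXh]; rfl
  rw [Fintype.sum_sum_type (fun c => Xh i c ^ 2), Fintype.sum_sum_type (fun c => X i c ^ 2), mul_add]
  have h3 : ∑ k, (Xh i (Sum.inl k)) ^ 2 ≤ 2 * ∑ k, (X i (Sum.inl k)) ^ 2
      + 2 * ∑ k, (((Fh - Matrix.diagonal s * F) * ymat y) k i) ^ 2 := by
    rw [Finset.mul_sum, Finset.mul_sum, ← Finset.sum_add_distrib]
    refine Finset.sum_le_sum fun k _ => ?_
    rw [hin k]
    have := hs k
    have e : (s k * X i (Sum.inl k)) ^ 2 = (X i (Sum.inl k)) ^ 2 := by rw [mul_pow, this, one_mul]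
    rw [← e]
    nlinarith [sq_nonneg (((Fh - Matrix.diagonal s * F) * ymat y) k i - s k * X i (Sum.inl k))]
  have h4 : ∑ c, (Xh i (Sum.inr c)) ^ 2 ≤ 2 * ∑ c, (X i (Sum.inr c)) ^ 2 := by
    simp only [hinr]
    have : 0 ≤ ∑ c, (X i (Sum.inr c)) ^ 2 := Finset.sum_nonneg fun _ _ => sq_nonneg _
    linarith
  linarith

/-- Rewriting the averaged tensor as an averaged matrix product. -/
lemma frobT_avg_le {N r T : ℕ} {p : Type*} [Fintype p] (D : ℕ → Matrix (Fin r) (Fin N × Fin N) ℝ)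
    (G : ℕ → Matrix p (Fin N) ℝ) (y : ℕ → Fin N → ℝ) {A B : ℝ}
    (hA : (T : ℝ)⁻¹ * ∑ t ∈ Finset.Icc 1 T, n2 (G t) ≤ A)
    (hB : (T : ℝ)⁻¹ * ∑ t ∈ Finset.Icc 1 T, n2 (D t * ymat (y t)) ≤ B) :
    frobT ((T : ℝ)⁻¹ • ∑ t ∈ Finset.Icc 1 T,
      mode2 (mode1 (fun i j k => D t k (i, j)) (G t)) (Matrix.of fun (_ : Fin 1) j => y t j))
      ≤ Real.sqrt (A * B) := by
  unfold frobT
  refine Real.sqrt_le_sqrt ?_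
  have h := n2_avg_mul_le T G (fun t => (D t * ymat (y t))ᵀ)
  simp only [n2_transpose] at h
  have hB0 : 0 ≤ (T : ℝ)⁻¹ * ∑ t ∈ Finset.Icc 1 T, n2 (D t * ymat (y t)) :=
    mul_nonneg (by positivity) (Finset.sum_nonneg fun _ _ => n2_nonneg _)
  have hA0 : 0 ≤ (T : ℝ)⁻¹ * ∑ t ∈ Finset.Icc 1 T, n2 (G t) :=
    mul_nonneg (by positivity) (Finset.sum_nonneg fun _ _ => n2_nonneg _)
  refine le_trans (le_of_eq ?_) (h.trans (mul_le_mul hA hB hB0 (hA0.trans hA)))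
  unfold n2
  refine Finset.sum_congr rfl fun i _ => ?_
  rw [Fintype.sum_unique]
  refine Finset.sum_congr rfl fun k _ => ?_
  congr 1
  rw [Matrix.smul_apply, Matrix.sum_apply]
  simp only [Pi.smul_apply, Finset.sum_apply, smul_eq_mul]
  congr 1
  refine Finset.sum_congr rfl fun t _ => ?_
  simp only [mode2, mode1, Matrix.mul_apply (M := G t), Matrix.transpose_apply, mul_ymat,
    Matrix.of_apply, Finset.mul_sum]
  rw [Finset.sum_comm]
  exact Finset.sum_congr rfl fun _ _ => Finset.sum_congr rfl fun _ _ => by ring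

/-- A positive lower bound of a finite positive family. -/
lemma exists_pos_le {ι : Type*} [Finite ι] (f : ι → ℝ) (hf : ∀ i, 0 < f i) :
    ∃ g : ℝ, 0 < g ∧ ∀ i, g ≤ f i := by
  cases isEmpty_or_nonempty ι
  · exact ⟨1, one_pos, fun i => isEmptyElim i⟩
  · obtain ⟨i, hi⟩ := Finite.exists_min f
    exact ⟨f i, hf i, hi⟩

/-- Uniform spectral gap. -/
lemma spectral_gap {r : ℕ} (clo cup : Fin r → ℝ) (hclo : ∀ j, 0 < clo j)
    (hsep : ∀ j k : Fin r, (j : ℕ) + 1 = (k : ℕ) → cup k < clo j) :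
    ∃ γ κ : ℝ, 0 < γ ∧ 0 ≤ κ ∧ ∀ (m : ℕ) (μ : Fin r → ℝ),
      (∀ j k : Fin r, j < k → μ k < μ j) → (∀ j, clo j * m < μ j ∧ μ j < cup j * m) →
      (∀ i j, i ≠ j → γ * m ≤ |μ i - μ j|) ∧ (∀ j, γ * m ≤ μ j) ∧ (∀ j, μ j ≤ κ * m) := by
  obtain ⟨γ, hγ, hle⟩ := exists_pos_le
    (fun p : Fin r × Fin r => if (p.1 : ℕ) + 1 = p.2 then clo p.1 - cup p.2 else clo p.1)
    (fun p => by
      split_ifs with h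
      · linarith [hsep _ _ h]
      · exact hclo _)
  refine ⟨γ, ∑ j, |cup j|, hγ, Finset.sum_nonneg fun _ _ => abs_nonneg _, ?_⟩
  intro m μ hdec hb
  have hm : (0 : ℝ) ≤ m := Nat.cast_nonneg m
  have hlt : ∀ i j : Fin r, i < j → γ * m ≤ μ i - μ j := by
    intro i j hij
    have hij' : (i : ℕ) < j := hij
    let k : Fin r := ⟨i + 1, by omega⟩
    have h1 := hle (i, k)
    simp only [k, if_true] at h1
    have h2 : μ j ≤ μ k := by
      rcases (show k ≤ j from hij').eq_or_lt with h | h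
      · rw [h]
      · exact (hdec k j h).le
    have h3 := (hb i).1
    have h4 := (hb k).2
    have h5 : γ * m ≤ (clo i - cup k) * m := mul_le_mul_of_nonneg_right h1 hm
    linarith
  refine ⟨fun i j hij => ?_, fun j => ?_, fun j => ?_⟩
  · rcases lt_or_gt_of_ne hij with h | h
    · exact (hlt i j h).trans (le_abs_self _)
    · rw [abs_sub_comm]; exact (hlt j i h).trans (le_abs_self _)
  · have h1 := hle (j, j)
    simp only [Nat.succ_ne_self, Nat.add_eq_left, one_ne_zero, if_false] at h1
    exact (mul_le_mul_of_nonneg_right h1 hm).trans (hb j).1.le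
  · refine (hb j).2.le.trans (mul_le_mul_of_nonneg_right ?_ hm)
    exact (le_abs_self _).trans
      (Finset.single_le_sum (f := fun j => |cup j|) (fun _ _ => abs_nonneg _) (Finset.mem_univ j))

section Core
variable {Ω : Type*} [MeasurableSpace Ω] {P : Measure Ω}

/-- Everything that is needed about one probability space. -/
lemma core [IsProbabilityMeasure P] {N r m T : ℕ} (hm : 0 < m) (hT : 1 ≤ T)
    {χ E W : ℕ → Ω → Matrix (Fin m) (Fin N × Fin N) ℝ}
    (hW : ∀ t ω, W t ω = χ t ω + E t ω)
    {V : Matrix (Fin m) (Fin r) ℝ} {μ : Fin r → ℝ} (hV : Vᵀ * V = 1) (hμ : ∀ j, 0 < μ j)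
    (hdec : ∀ j k : Fin r, j < k → μ k < μ j)
    (hχ : ∀ t, t ≤ T → ∀ i j, Integrable (fun ω => (χ t ω * (χ t ω)ᵀ) i j) P ∧
      ∫ ω, (χ t ω * (χ t ω)ᵀ) i j ∂P = (V * Matrix.diagonal μ * Vᵀ) i j)
    {F : ℕ → Ω → Matrix (Fin r) (Fin N × Fin N) ℝ}
    (hF : ∀ t ω, F t ω = Matrix.diagonal (fun j => (Real.sqrt (μ j))⁻¹) * Vᵀ * χ t ω)
    (hEF : ∀ t, t ≤ T → ∀ i j, Integrable (fun ω => (E t ω * (F t ω)ᵀ) i j) P ∧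
      ∫ ω, (E t ω * (F t ω)ᵀ) i j ∂P = 0)
    {γ κ : ℝ} (hγ : 0 < γ) (hκ : 0 ≤ κ) (hgap : ∀ i j, i ≠ j → γ * m ≤ |μ i - μ j|)
    (hlow : ∀ j, γ * m ≤ μ j) (hup : ∀ j, μ j ≤ κ * m)
    {GE GW : Matrix (Fin m) (Fin m) ℝ} {l : ℝ} (hl : 0 < l)
    (hGE : ∀ t, t ≤ T → ∀ i j, Integrable (fun ω => (E t ω * (E t ω)ᵀ) i j) P ∧
      ∫ ω, (E t ω * (E t ω)ᵀ) i j ∂P = GE i j)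
    (hlam : ∀ x : Fin m → ℝ, x ⬝ᵥ GE.mulVec x ≤ l * (x ⬝ᵥ x))
    {Gh : Ω → Matrix (Fin m) (Fin m) ℝ}
    (hGh : ∀ ω, Gh ω = (T : ℝ)⁻¹ • ∑ t ∈ Finset.Icc 1 T, W t ω * (W t ω)ᵀ)
    (hGW : ∀ t, t ≤ T → ∀ i j, Integrable (fun ω => (W t ω * (W t ω)ᵀ) i j) P ∧
      ∫ ω, (W t ω * (W t ω)ᵀ) i j ∂P = GW i j)
    {R : ℝ}
    (hA6 : ∀ i j, Integrable (fun ω => (Gh ω i j - GW i j) ^ 2) P ∧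
      (T : ℝ) * ∫ ω, (Gh ω i j - GW i j) ^ 2 ∂P ≤ R)
    {μh : Ω → Fin r → ℝ} {Vh : Ω → Matrix (Fin m) (Fin r) ℝ}
    (hVh : ∀ ω, (Vh ω)ᵀ * Vh ω = 1)
    (hEig : ∀ ω, Gh ω * Vh ω = Vh ω * Matrix.diagonal (μh ω))
    (hah : ∀ ω, Antitone (μh ω))
    (hTop : ∀ ω (ν' : ℝ) (x : Fin m → ℝ), x ≠ 0 → (Gh ω).mulVec x = ν' • x →
      (Vh ω)ᵀ.mulVec x = 0 → ∀ j, ν' ≤ μh ω j)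
    {Fh : ℕ → Ω → Matrix (Fin r) (Fin N × Fin N) ℝ}
    (hFh : ∀ t ω, Fh t ω = Matrix.diagonal (fun j => (Real.sqrt (μh ω j))⁻¹) * (Vh ω)ᵀ * W t ω)
    {y ν : ℕ → Ω → (Fin N → ℝ)} {X : ℕ → Ω → Matrix (Fin N) (Fin r ⊕ Fin N ⊕ Fin N) ℝ}
    (hX : ∀ t ω, X t ω = Matrix.of fun i c =>
      Sum.elim (fun k => ∑ j, F (t - 1) ω k (i, j) * y (t - 1) ω j)
        (Sum.elim (fun i' => if i = i' then y (t - 1) ω i else 0)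
          (fun i' => if i = i' then (1 : ℝ) else 0)) c)
    {M : ℝ}
    (hA7 : ∀ t, 1 ≤ t → t ≤ T → Integrable (fun ω => (frobNorm (X t ω)) ^ 8) P ∧
      ∫ ω, (frobNorm (X t ω)) ^ 8 ∂P ≤ M)
    (hind : ∀ t s, 1 ≤ t → t ≤ T → s ≤ T →
      IndepFun
        (fun ω => ((fun i c => X t ω i c : Fin N → (Fin r ⊕ Fin N ⊕ Fin N) → ℝ),
          (fun i => ν t ω i : Fin N → ℝ)))
        (fun ω => (fun i j => E s ω i j : Fin m → (Fin N × Fin N) → ℝ)) P) :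
    ∃ (e : Ω → ℝ) (Q : ℕ → Ω → ℝ) (Z : Ω → ℝ),
      ((∀ ω, 0 ≤ e ω) ∧ Integrable e P ∧
        ∫ ω, e ω ∂P ≤ 2 * (|R| + l ^ 2) * (min (m : ℝ) T)⁻¹) ∧
      (∀ t, t ≤ T → (∀ ω, 0 ≤ Q t ω) ∧ Integrable (Q t) P ∧ ∫ ω, Q t ω ∂P ≤ r + l + r * l) ∧
      ((∀ ω, 0 ≤ Z ω) ∧ Integrable Z P ∧ ∫ ω, Z ω ∂P ≤ (1 + M) * (1 + l + r * l)) ∧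
      (∀ t, t ≤ T → ∀ᵐ ω ∂P, e ω ≤ γ ^ 2 / 4 →
        n2 (Fh t ω - Matrix.diagonal (sgnVec V (Vh ω)) * F t ω)
          ≤ Kc r γ κ * (e ω + (m : ℝ)⁻¹) * Q t ω) ∧
      (∀ᵐ ω ∂P, e ω ≤ γ ^ 2 / 4 →
        (T : ℝ)⁻¹ * ∑ t ∈ Finset.Icc 1 T, n2 ((Fh (t - 1) ω -
          Matrix.diagonal (sgnVec V (Vh ω)) * F (t - 1) ω) * ymat (y (t - 1) ω))
          ≤ Kc r γ κ * (e ω + (m : ℝ)⁻¹) * Z ω) ∧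
      (∀ ω, (T : ℝ)⁻¹ * ∑ t ∈ Finset.Icc 1 T, n2 (X t ω) ≤ Z ω) := by
  have hm' : (0 : ℝ) < m := by exact_mod_cast hm
  have hT' : (0 : ℝ) < T := by exact_mod_cast hT
  have hGhs : ∀ ω, (Gh ω)ᵀ = Gh ω := by
    intro ω
    rw [hGh, Matrix.transpose_smul, Matrix.transpose_sum]
    simp only [Matrix.transpose_mul, Matrix.transpose_transpose]
  have hanti : Antitone μ := by
    intro i j hij
    rcases hij.eq_or_lt with h | h
    · rw [h]
    · exact (hdec i j h).le
  have hsum := cov_sum (P := P) hV hμ (hW 0) (hχ 0 (Nat.zero_le _)) (hF 0) (hEF 0 (Nat.zero_le _))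
    (hGE 0 (Nat.zero_le _)) (hGW 0 (Nat.zero_le _))
  obtain ⟨hs, hps⟩ := cov_psd (hGE 0 (Nat.zero_le _))
  obtain ⟨e, he0, hei, heI, heb⟩ := cov_err (P := P) hm hT hsum (psd_frob hs hps hl hlam) hA6
  have hspan : ∀ t, t ≤ T → ∀ᵐ ω ∂P, χ t ω = V * Vᵀ * χ t ω := fun t ht =>
    common_span hV (hχ t ht)
  have hfb : ∀ t, t ≤ T → ∀ᵐ ω ∂P, e ω ≤ γ ^ 2 / 4 → ∀ {p : Type} [Fintype p]
      (Y : Matrix (Fin N × Fin N) p ℝ),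
      n2 ((Fh t ω - Matrix.diagonal (sgnVec V (Vh ω)) * F t ω) * Y) ≤
      Kc r γ κ * (e ω + (m : ℝ)⁻¹) * (n2 (F t ω * Y) + n2 (E t ω * Y) / m
        + n2 (Vᵀ * E t ω * Y)) := by
    intro t ht
    filter_upwards [hspan t ht] with ω hω hle p _ Y
    exact factor_bound hm hV (hVh ω) hanti (hah ω) (hGhs ω) (hEig ω) (hTop ω) hγ hκ hgap hlow hup
      (heb ω) hle hω (hF t ω) (by rw [hFh, hW]) Y
  have hEm : ∀ t, t ≤ T → _ := fun t ht => E_moment (P := P) hV (hGE t ht) hlam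
  have hFm : ∀ t, t ≤ T → _ := fun t ht => F_moment (P := P) hV hμ (hχ t ht) (hF t)
  have hK := Kc_pos r hγ hκ
  let Zt : ℕ → Ω → ℝ := fun t ω => n2 (X t ω) + n2 (X t ω) * n2 (E (t - 1) ω) * (m : ℝ)⁻¹
    + n2 (X t ω) * n2 (Vᵀ * E (t - 1) ω)
  have hZt0 : ∀ t ω, n2 (X t ω) ≤ Zt t ω := by
    intro t ω
    have h1 := n2_nonneg (X t ω)
    have h2 := n2_nonneg (E (t - 1) ω)
    have h3 := n2_nonneg (Vᵀ * E (t - 1) ω)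
    have : 0 ≤ n2 (X t ω) * n2 (E (t - 1) ω) * (m : ℝ)⁻¹ := by positivity
    have : 0 ≤ n2 (X t ω) * n2 (Vᵀ * E (t - 1) ω) := by positivity
    simp only [Zt]; linarith
  have hZtI : ∀ t, 1 ≤ t → t ≤ T → Integrable (Zt t) P ∧
      ∫ ω, Zt t ω ∂P ≤ (1 + M) * (1 + l + r * l) := by
    intro t h1 ht
    have hs' : t - 1 ≤ T := (Nat.sub_le _ _).trans ht
    obtain ⟨hx, hxI⟩ := x_moment (hA7 t h1 ht)
    obtain ⟨⟨ha, haI⟩, ⟨hb, hbI⟩⟩ := hEm (t - 1) hs'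
    have i1 := indep_moment (hind t (t - 1) h1 ht hs') (1 : Matrix (Fin m) (Fin m) ℝ) hx
      (by simp only [Matrix.one_mul]; exact ha)
    have i2 := indep_moment (hind t (t - 1) h1 ht hs') Vᵀ hx hb
    simp only [Matrix.one_mul] at i1
    have j1 : Integrable (fun ω => n2 (X t ω) * n2 (E (t - 1) ω)) P := i1.1
    have j2 : Integrable (fun ω => n2 (X t ω) * n2 (Vᵀ * E (t - 1) ω)) P := i2.1
    have k1 : ∫ ω, n2 (X t ω) * n2 (E (t - 1) ω) ∂P
      = (∫ ω, n2 (X t ω) ∂P) * ∫ ω, n2 (E (t - 1) ω) ∂P := i1.2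
    have k2 : ∫ ω, n2 (X t ω) * n2 (Vᵀ * E (t - 1) ω) ∂P
      = (∫ ω, n2 (X t ω) ∂P) * ∫ ω, n2 (Vᵀ * E (t - 1) ω) ∂P := i2.2
    have j1' := j1.mul_const ((m : ℝ)⁻¹)
    have j3 : Integrable (fun ω => n2 (X t ω) + n2 (X t ω) * n2 (E (t - 1) ω) * (m : ℝ)⁻¹) P :=
      hx.add j1'
    refine ⟨j3.add j2, ?_⟩
    have : ∫ ω, Zt t ω ∂P = (∫ ω, n2 (X t ω) ∂P) * (1 + (∫ ω, n2 (E (t - 1) ω) ∂P) * (m : ℝ)⁻¹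
        + ∫ ω, n2 (Vᵀ * E (t - 1) ω) ∂P) := by
      simp only [Zt]
      rw [integral_add j3 j2, integral_add hx j1', integral_mul_const, k1, k2]
      ring
    rw [this]
    have p1 : 0 ≤ ∫ ω, n2 (X t ω) ∂P := integral_nonneg fun ω => n2_nonneg _
    have p2 : (∫ ω, n2 (E (t - 1) ω) ∂P) * (m : ℝ)⁻¹ ≤ l := by
      rw [← div_eq_mul_inv, div_le_iff₀ hm']; linarith
    have p3 : 0 ≤ ∫ ω, n2 (E (t - 1) ω) ∂P := integral_nonneg fun ω => n2_nonneg _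
    have p4 : 0 ≤ ∫ ω, n2 (Vᵀ * E (t - 1) ω) ∂P := integral_nonneg fun ω => n2_nonneg _
    exact mul_le_mul hxI (by linarith) (by positivity) (by linarith)
  refine ⟨e, fun t ω => n2 (F t ω) + n2 (E t ω) * (m : ℝ)⁻¹ + n2 (Vᵀ * E t ω),
    fun ω => (T : ℝ)⁻¹ * ∑ t ∈ Finset.Icc 1 T, Zt t ω, ⟨he0, hei, heI⟩, ?_, ⟨?_, ?_, ?_⟩, ?_, ?_, ?_⟩
  · intro t ht
    obtain ⟨⟨ha, haI⟩, ⟨hb, hbI⟩⟩ := hEm t ht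
    obtain ⟨hc, hcI⟩ := hFm t ht
    have j1 := ha.mul_const ((m : ℝ)⁻¹)
    have j2 : Integrable (fun ω => n2 (F t ω) + n2 (E t ω) * (m : ℝ)⁻¹) P := hc.add j1
    refine ⟨fun ω => ?_, j2.add hb, ?_⟩
    · have h1 := n2_nonneg (F t ω)
      have h2 := n2_nonneg (E t ω)
      have h3 := n2_nonneg (Vᵀ * E t ω)
      positivity
    · rw [integral_add j2 hb, integral_add hc j1, integral_mul_const, hcI]
      have p2 : (∫ ω, n2 (E t ω) ∂P) * (m : ℝ)⁻¹ ≤ l := by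
        rw [← div_eq_mul_inv, div_le_iff₀ hm']; linarith
      linarith
  · intro ω
    exact mul_nonneg (by positivity)
      (Finset.sum_nonneg fun t _ => (n2_nonneg _).trans (hZt0 t ω))
  · exact (integrable_finsetSum _ fun t ht =>
      (hZtI t (Finset.mem_Icc.1 ht).1 (Finset.mem_Icc.1 ht).2).1).const_mul _
  · rw [integral_const_mul, integral_finsetSum _ fun t ht =>
      (hZtI t (Finset.mem_Icc.1 ht).1 (Finset.mem_Icc.1 ht).2).1]
    have := Finset.sum_le_card_nsmul (Finset.Icc 1 T) (fun t => ∫ ω, Zt t ω ∂P) _ fun t ht =>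
      (hZtI t (Finset.mem_Icc.1 ht).1 (Finset.mem_Icc.1 ht).2).2
    rw [inv_mul_le_iff₀ hT']
    refine this.trans (le_of_eq ?_)
    simp
  · intro t ht
    filter_upwards [hfb t ht] with ω hω hle
    have := hω hle (1 : Matrix (Fin N × Fin N) (Fin N × Fin N) ℝ)
    simpa only [Matrix.mul_one, div_eq_mul_inv] using this
  · have hall : ∀ᵐ ω ∂P, ∀ t, t ≤ T → e ω ≤ γ ^ 2 / 4 → ∀ {p : Type} [Fintype p]
        (Y : Matrix (Fin N × Fin N) p ℝ),
        n2 ((Fh t ω - Matrix.diagonal (sgnVec V (Vh ω)) * F t ω) * Y) ≤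
        Kc r γ κ * (e ω + (m : ℝ)⁻¹) * (n2 (F t ω * Y) + n2 (E t ω * Y) / m
          + n2 (Vᵀ * E t ω * Y)) := by
      rw [ae_all_iff]
      intro t
      by_cases ht : t ≤ T
      · filter_upwards [hfb t ht] with ω hω _ using hω
      · exact ae_of_all _ fun ω h => absurd h ht
    filter_upwards [hall] with ω hω hle
    rw [mul_left_comm]
    refine mul_le_mul_of_nonneg_left ?_ (by positivity)
    rw [Finset.mul_sum]
    refine Finset.sum_le_sum fun t ht => ?_
    have hs' : t - 1 ≤ T := (Nat.sub_le _ _).trans (Finset.mem_Icc.1 ht).2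
    refine (hω (t - 1) hs' hle (ymat (y (t - 1) ω))).trans ?_
    have hc : 0 ≤ Kc r γ κ * (e ω + (m : ℝ)⁻¹) := by
      have := he0 ω
      positivity
    refine mul_le_mul_of_nonneg_left ?_ hc
    have hd := n2_design (F (t - 1) ω) (y (t - 1) ω) (X t ω) (hX t ω)
    have hy0 : 0 ≤ ∑ i, y (t - 1) ω i ^ 2 := Finset.sum_nonneg fun _ _ => sq_nonneg _
    have hf0 := n2_nonneg (F (t - 1) ω * ymat (y (t - 1) ω))
    have hyX : ∑ i, y (t - 1) ω i ^ 2 ≤ n2 (X t ω) := by linarith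
    have q1 := (n2_mul_ymat_le (E (t - 1) ω) (y (t - 1) ω)).trans
      (mul_le_mul_of_nonneg_left hyX (n2_nonneg _))
    have q2 := (n2_mul_ymat_le (Vᵀ * E (t - 1) ω) (y (t - 1) ω)).trans
      (mul_le_mul_of_nonneg_left hyX (n2_nonneg _))
    have q3 := mul_le_mul_of_nonneg_right q1 (show (0 : ℝ) ≤ (m : ℝ)⁻¹ by positivity)
    simp only [Zt, div_eq_mul_inv]
    linarith
  · intro ω
    exact mul_le_mul_of_nonneg_left (Finset.sum_le_sum fun t _ => hZt0 t ω) (by positivity)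

/-- Turning moment bounds into a bound in probability. -/
lemma op_bound [IsProbabilityMeasure P] {e Z D : Ω → ℝ} {A B K g ε m n : ℝ}
    (he : (∀ ω, 0 ≤ e ω) ∧ Integrable e P ∧ ∫ ω, e ω ∂P ≤ A * n⁻¹)
    (hZ : (∀ ω, 0 ≤ Z ω) ∧ Integrable Z P ∧ ∫ ω, Z ω ∂P ≤ B)
    (hK : 0 ≤ K) (hg : 0 < g) (hε : 0 < ε) (hA : 0 ≤ A) (hB : 0 ≤ B) (hn : 0 < n) (hnm : n ≤ m)
    (hD : ∀ᵐ ω ∂P, e ω ≤ g → D ω ≤ K * (e ω + m⁻¹) * Z ω)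
    (hbig : 4 * (A + 1) / ε / g ≤ n) :
    ∃ Bad : Set Ω, P Bad < ENNReal.ofReal ε ∧ ∀ ω, ω ∉ Bad →
      Z ω ≤ 4 * (B + 1) / ε ∧
      D ω ≤ (K * (4 * (A + 1) / ε + 1) * (4 * (B + 1) / ε)) * n⁻¹ := by
  obtain ⟨he0, hei, heI⟩ := he
  obtain ⟨hZ0, hZi, hZI⟩ := hZ
  set C1 := 4 * (A + 1) / ε with hC1
  set C2 := 4 * (B + 1) / ε with hC2
  have hC1p : 0 < C1 := by positivity
  have hC2p : 0 < C2 := by positivity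
  have m1 := markov_lt he0 hei heI (show 0 < C1 * n⁻¹ by positivity)
  have m2 := markov_lt hZ0 hZi hZI hC2p
  have b1 : A * n⁻¹ / (C1 * n⁻¹) ≤ ε / 4 := by
    rw [div_le_iff₀ (by positivity), hC1]
    have : ε / 4 * (4 * (A + 1) / ε * n⁻¹) = (A + 1) * n⁻¹ := by field_simp
    rw [this]
    have : 0 < n⁻¹ := by positivity
    nlinarith
  have b2 : B / C2 ≤ ε / 4 := by
    rw [div_le_iff₀ (by positivity), hC2]
    have : ε / 4 * (4 * (B + 1) / ε) = (B + 1) := by field_simp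
    rw [this]; linarith
  refine ⟨({ω | C1 * n⁻¹ < e ω} ∪ {ω | C2 < Z ω}) ∪
    {ω | ¬ (e ω ≤ g → D ω ≤ K * (e ω + m⁻¹) * Z ω)}, ?_, ?_⟩
  · refine (measure_union_le _ _).trans_lt ?_
    rw [show P {ω | ¬ (e ω ≤ g → D ω ≤ K * (e ω + m⁻¹) * Z ω)} = 0 from hD, add_zero]
    refine (measure_union_le _ _).trans_lt ?_
    refine (add_le_add (m1.trans (ENNReal.ofReal_le_ofReal b1))
      (m2.trans (ENNReal.ofReal_le_ofReal b2))).trans_lt ?_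
    rw [← ENNReal.ofReal_add (by positivity) (by positivity),
      ENNReal.ofReal_lt_ofReal_iff hε]
    linarith
  · intro ω hω
    simp only [Set.mem_union, Set.mem_ofPred_eq, not_or, not_not, not_lt] at hω
    obtain ⟨⟨h1, h2⟩, h3⟩ := hω
    refine ⟨h2, ?_⟩
    have hg' : e ω ≤ g := by
      refine h1.trans ?_
      rw [← div_eq_mul_inv, div_le_iff₀ hn]
      rw [div_le_iff₀ hg] at hbig
      linarith
    refine (h3 hg').trans ?_
    have hmn : m⁻¹ ≤ n⁻¹ := by gcongr
    have : e ω + m⁻¹ ≤ (C1 + 1) * n⁻¹ := by linarith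
    have h0 := he0 ω
    have hm0 : 0 ≤ m⁻¹ := by have := hn.trans_le hnm; positivity
    calc K * (e ω + m⁻¹) * Z ω ≤ K * ((C1 + 1) * n⁻¹) * C2 := by
          refine mul_le_mul (mul_le_mul_of_nonneg_left this hK) h2 (hZ0 ω) (by positivity)
      _ = _ := by ring

end Core

lemma min_sqrt_inv (m T : ℕ) :
    (min (Real.sqrt m) (Real.sqrt T))⁻¹ = Real.sqrt ((min (m : ℝ) T)⁻¹) := by
  rw [Real.sqrt_inv]
  congr 1
  rcases le_total (m : ℝ) T with h | h
  · rw [min_eq_left h, min_eq_left (Real.sqrt_le_sqrt h)]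
  · rw [min_eq_right h, min_eq_right (Real.sqrt_le_sqrt h)]

lemma max_sqrt_inv {m T : ℕ} (hm : 0 < m) (hT : 0 < T) :
    max (Real.sqrt T)⁻¹ (Real.sqrt m)⁻¹ = Real.sqrt ((min (m : ℝ) T)⁻¹) := by
  rw [← min_sqrt_inv]
  have h1 : 0 < Real.sqrt m := Real.sqrt_pos.2 (by exact_mod_cast hm)
  have h2 : 0 < Real.sqrt T := Real.sqrt_pos.2 (by exact_mod_cast hT)
  rcases le_total (Real.sqrt m) (Real.sqrt T) with h | h
  · rw [min_eq_left h, max_eq_right (inv_anti₀ h1 h)]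
  · rw [min_eq_right h, max_eq_left (inv_anti₀ h2 h)]

/-- The plim in Assumption 8 bounds the average squared innovation. -/
lemma nu_bound {N r T : ℕ} (X : ℕ → Matrix (Fin N) (Fin r ⊕ Fin N ⊕ Fin N) ℝ)
    (ν : ℕ → Fin N → ℝ) (hX : ∀ t i i', X t i (Sum.inr (Sum.inr i')) = if i = i' then 1 else 0)
    (S : Matrix (Fin r ⊕ Fin N ⊕ Fin N) (Fin r ⊕ Fin N ⊕ Fin N) ℝ)
    (h : frobNorm (((T : ℝ)⁻¹ • ∑ t ∈ Finset.Icc 1 T,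
              Matrix.vecMulVec ((X t)ᵀ.mulVec (ν t)) ((X t)ᵀ.mulVec (ν t))) - S) ≤ 1) :
    (T : ℝ)⁻¹ * ∑ t ∈ Finset.Icc 1 T, n2 (Matrix.of fun (_ : Fin 1) j => ν t j)
      ≤ ∑ i : Fin N, (|S (Sum.inr (Sum.inr i)) (Sum.inr (Sum.inr i))| + 1) := by
  have hent : ∀ i : Fin N, (T : ℝ)⁻¹ * ∑ t ∈ Finset.Icc 1 T, ν t i ^ 2
      ≤ |S (Sum.inr (Sum.inr i)) (Sum.inr (Sum.inr i))| + 1 := by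
    intro i
    have h1 := n2_entry_le (((T : ℝ)⁻¹ • ∑ t ∈ Finset.Icc 1 T,
              Matrix.vecMulVec ((X t)ᵀ.mulVec (ν t)) ((X t)ᵀ.mulVec (ν t))) - S)
              (Sum.inr (Sum.inr i)) (Sum.inr (Sum.inr i))
    rw [← frobNorm_sq] at h1
    have h0 : 0 ≤ frobNorm (((T : ℝ)⁻¹ • ∑ t ∈ Finset.Icc 1 T,
              Matrix.vecMulVec ((X t)ᵀ.mulVec (ν t)) ((X t)ᵀ.mulVec (ν t))) - S) :=
      Real.sqrt_nonneg _
    have h2 := (sq_le_sq₀ h0 zero_le_one).2 h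
    have h3 := h1.trans h2
    rw [sq_le_sq, abs_one] at h3
    have h4 : (((T : ℝ)⁻¹ • ∑ t ∈ Finset.Icc 1 T,
              Matrix.vecMulVec ((X t)ᵀ.mulVec (ν t)) ((X t)ᵀ.mulVec (ν t))) - S)
              (Sum.inr (Sum.inr i)) (Sum.inr (Sum.inr i)) =
        (T : ℝ)⁻¹ * ∑ t ∈ Finset.Icc 1 T, ν t i ^ 2
          - S (Sum.inr (Sum.inr i)) (Sum.inr (Sum.inr i)) := by
      rw [Matrix.sub_apply, Matrix.smul_apply, Matrix.sum_apply, smul_eq_mul]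
      congr 2
      refine Finset.sum_congr rfl fun t _ => ?_
      have : (X t)ᵀ.mulVec (ν t) (Sum.inr (Sum.inr i)) = ν t i := by
        simp [Matrix.mulVec, dotProduct, hX]
      rw [Matrix.vecMulVec_apply, this, pow_two]
    rw [h4] at h3
    have h5 := (abs_le.1 h3).2
    have h6 := le_abs_self (S (Sum.inr (Sum.inr i)) (Sum.inr (Sum.inr i)))
    linarith
  refine le_trans (le_of_eq ?_) (Finset.sum_le_sum fun i _ => hent i)
  unfold n2
  simp only [Fintype.sum_unique, Matrix.of_apply]
  rw [← Finset.mul_sum, Finset.sum_comm]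

/-- **Lemma 1.** Rates for the cross-products between the factor estimation error
`F̂_{t−1} − F_{t−1} ×₃ Ĵ_r` and `X_t`, `X̂_t` and `ν_t`, under Assumptions 1–9,
as `m, T → ∞`. -/
theorem lemma1

    (N r : ℕ) (hr : 0 < r) (hN : 0 < N)
    -- a probability space for each pair (m, T)
    (Ω : ℕ → ℕ → Type) (instΩ : ∀ m T, MeasurableSpace (Ω m T))
    (P : ∀ m T, Measure (Ω m T)) (hP : ∀ m T, IsProbabilityMeasure (P m T))
    -- common and idiosyncratic components of the matricized weight tensor
    (χ Err W : ∀ m T : ℕ, ℕ → Ω m T → Matrix (Fin m) (Fin N × Fin N) ℝ)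
    (hW : ∀ m T t ω, W m T t ω = χ m T t ω + Err m T t ω)
    -- Assumption 1: spectral data of Γ^χ = E[χ_t·χ_tᵀ], factors and loadings
    (V : ∀ m T : ℕ, Matrix (Fin m) (Fin r) ℝ) (μ : ℕ → ℕ → Fin r → ℝ)
    (hVorth : ∀ m T, r ≤ m → (V m T)ᵀ * V m T = 1)
    (hμpos : ∀ m T j, 0 < μ m T j)
    (hμdec : ∀ m T, ∀ j k : Fin r, j < k → μ m T k < μ m T j)
    (hΓχ : ∀ m T t, t ≤ T → ∀ i j,
      Integrable (fun ω => (χ m T t ω * (χ m T t ω)ᵀ) i j) (P m T) ∧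
      ∫ ω, (χ m T t ω * (χ m T t ω)ᵀ) i j ∂(P m T)
        = (V m T * Matrix.diagonal (μ m T) * (V m T)ᵀ) i j)
    (F : ∀ m T : ℕ, ℕ → Ω m T → Matrix (Fin r) (Fin N × Fin N) ℝ)
    (hF : ∀ m T t ω, F m T t ω
      = Matrix.diagonal (fun j => (Real.sqrt (μ m T j))⁻¹) * (V m T)ᵀ * χ m T t ω)
    (U : ∀ m T : ℕ, Matrix (Fin m) (Fin r) ℝ)
    (hU : ∀ m T, U m T = V m T * Matrix.diagonal (fun j => Real.sqrt (μ m T j)))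
    -- Assumption 2: idiosyncratic moments
    (hEmean : ∀ m T t, t ≤ T → ∀ i j,
      Integrable (fun ω => Err m T t ω i j) (P m T) ∧
      ∫ ω, Err m T t ω i j ∂(P m T) = 0)
    (hE4 : ∀ m T t, t ≤ T →
      Integrable (fun ω => (frobNorm (Err m T t ω)) ^ 4) (P m T))
    -- Assumption 3: errors and factors uncorrelated
    (hEF : ∀ m T t, t ≤ T → ∀ i j,
      Integrable (fun ω => (Err m T t ω * (F m T t ω)ᵀ) i j) (P m T) ∧
      ∫ ω, (Err m T t ω * (F m T t ω)ᵀ) i j ∂(P m T) = 0)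
    -- Assumption 4: pervasiveness of the common factors
    (clo cup : Fin r → ℝ)
    (hclo : ∀ j, 0 < clo j)
    (hsep : ∀ j k : Fin r, (j : ℕ) + 1 = (k : ℕ) → cup k < clo j)
    (hperv : ∃ m₀, ∀ m, m₀ ≤ m → ∀ T, ∀ j,
      clo j * m < μ m T j ∧ μ m T j < cup j * m)
    -- Assumption 5: non-pervasiveness of the idiosyncratic components
    (ΓE : ∀ m T : ℕ, Matrix (Fin m) (Fin m) ℝ) (lam : ℝ)
    (hΓE : ∀ m T t, t ≤ T → ∀ i j,
      Integrable (fun ω => (Err m T t ω * (Err m T t ω)ᵀ) i j) (P m T) ∧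
      ∫ ω, (Err m T t ω * (Err m T t ω)ᵀ) i j ∂(P m T) = ΓE m T i j)
    (hlam : ∀ m T, ∀ x : Fin m → ℝ, x ⬝ᵥ (ΓE m T).mulVec x ≤ lam * (x ⬝ᵥ x))
    -- sample covariance Γ̂ = (1/T)·Σ_t W_(3)t·W_(3)tᵀ and population Γ^W
    (Γhat : ∀ m T : ℕ, Ω m T → Matrix (Fin m) (Fin m) ℝ)
    (hΓhat : ∀ m T ω, Γhat m T ω
      = (T : ℝ)⁻¹ • ∑ t ∈ Finset.Icc 1 T, W m T t ω * (W m T t ω)ᵀ)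
    (ΓW : ∀ m T : ℕ, Matrix (Fin m) (Fin m) ℝ)
    (hΓW : ∀ m T t, t ≤ T → ∀ i j,
      Integrable (fun ω => (W m T t ω * (W m T t ω)ᵀ) i j) (P m T) ∧
      ∫ ω, (W m T t ω * (W m T t ω)ᵀ) i j ∂(P m T) = ΓW m T i j)
    -- Assumption 6: convergence of the sample covariance
    (R : ℝ)
    (hA6 : ∀ m T, 1 ≤ T → ∀ i j,
      Integrable (fun ω => (Γhat m T ω i j - ΓW m T i j) ^ 2) (P m T) ∧
      (T : ℝ) * ∫ ω, (Γhat m T ω i j - ΓW m T i j) ^ 2 ∂(P m T) ≤ R)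
    -- estimated eigenvalues/eigenvectors of Γ̂ and estimated factors
    (μhat : ∀ m T : ℕ, Ω m T → Fin r → ℝ)
    (Vhat : ∀ m T : ℕ, Ω m T → Matrix (Fin m) (Fin r) ℝ)
    (hVhatOrth : ∀ m T ω, r ≤ m → (Vhat m T ω)ᵀ * Vhat m T ω = 1)
    (hEigen : ∀ m T ω, Γhat m T ω * Vhat m T ω
      = Vhat m T ω * Matrix.diagonal (μhat m T ω))
    (hμhatDec : ∀ m T ω, Antitone (μhat m T ω))
    (hTop : ∀ m T ω (ν' : ℝ) (x : Fin m → ℝ), x ≠ 0 →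
      (Γhat m T ω).mulVec x = ν' • x → (Vhat m T ω)ᵀ.mulVec x = 0 →
      ∀ j, ν' ≤ μhat m T ω j)
    (Fhat : ∀ m T : ℕ, ℕ → Ω m T → Matrix (Fin r) (Fin N × Fin N) ℝ)
    (hFhat : ∀ m T t ω, Fhat m T t ω
      = Matrix.diagonal (fun j => (Real.sqrt (μhat m T ω j))⁻¹) * (Vhat m T ω)ᵀ
          * W m T t ω)
    -- the FNAR model: y_t = X_t·θ + ν_t, θ = (β₁,…,β_r, ρ₁,…,ρ_N, α₁,…,α_N)
    (y ν : ∀ m T : ℕ, ℕ → Ω m T → (Fin N → ℝ))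
    (β : Fin r → ℝ) (ρ αc : Fin N → ℝ)
    (Xmat Xhat : ∀ m T : ℕ, ℕ → Ω m T → Matrix (Fin N) (Fin r ⊕ Fin N ⊕ Fin N) ℝ)
    (hXmat : ∀ m T t ω, Xmat m T t ω = Matrix.of fun i c =>
      Sum.elim (fun k => ∑ j, F m T (t - 1) ω k (i, j) * y m T (t - 1) ω j)
        (Sum.elim (fun i' => if i = i' then y m T (t - 1) ω i else 0)
          (fun i' => if i = i' then (1 : ℝ) else 0)) c)
    (hXhat : ∀ m T t ω, Xhat m T t ω = Matrix.of fun i c =>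
      Sum.elim (fun k => ∑ j, Fhat m T (t - 1) ω k (i, j) * y m T (t - 1) ω j)
        (Sum.elim (fun i' => if i = i' then y m T (t - 1) ω i else 0)
          (fun i' => if i = i' then (1 : ℝ) else 0)) c)
    (hModel : ∀ m T t, 1 ≤ t → t ≤ T → ∀ ω,
      y m T t ω = (Xmat m T t ω).mulVec (Sum.elim β (Sum.elim ρ αc)) + ν m T t ω)
    -- Assumption 7: E‖X_t‖_F⁸ ≤ M < ∞
    (Mbd : ℝ)
    (hA7 : ∀ m T t, 1 ≤ t → t ≤ T →
      Integrable (fun ω => (frobNorm (Xmat m T t ω)) ^ 8) (P m T) ∧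
      ∫ ω, (frobNorm (Xmat m T t ω)) ^ 8 ∂(P m T) ≤ Mbd)
    -- Assumption 8: T^{-1/2}·Σ_t X_tᵀν_t →d N(0, Σ_{Xν}),
    -- Σ_{Xν} = plim T^{-1}·Σ_t X_tᵀν_tν_tᵀX_t
    (SigXv : Matrix (Fin r ⊕ Fin N ⊕ Fin N) (Fin r ⊕ Fin N ⊕ Fin N) ℝ)
    (hplim : ∀ ε : ℝ, 0 < ε → ∀ δ : ℝ, 0 < δ → ∃ m₀ T₀ : ℕ, ∀ m T : ℕ,
      m₀ ≤ m → T₀ ≤ T →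
      P m T {ω | δ < frobNorm
          (((T : ℝ)⁻¹ • ∑ t ∈ Finset.Icc 1 T,
              Matrix.vecMulVec ((Xmat m T t ω)ᵀ.mulVec (ν m T t ω))
                ((Xmat m T t ω)ᵀ.mulVec (ν m T t ω))) - SigXv)}
        < ENNReal.ofReal ε)
    (hCLT : ∃ L : Measure ((Fin r ⊕ Fin N ⊕ Fin N) → ℝ),
      IsProbabilityMeasure L ∧
      (∀ l : (Fin r ⊕ Fin N ⊕ Fin N) → ℝ,
        L.map (fun x => ∑ c, l c * x c)
          = gaussianReal 0 (Real.toNNReal (l ⬝ᵥ SigXv.mulVec l))) ∧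
      (∀ f : BoundedContinuousFunction ((Fin r ⊕ Fin N ⊕ Fin N) → ℝ) ℝ,
        ∀ ε : ℝ, 0 < ε → ∃ m₀ T₀ : ℕ, ∀ m T : ℕ, m₀ ≤ m → T₀ ≤ T →
        |(∫ ω, f ((Real.sqrt T)⁻¹ • ∑ t ∈ Finset.Icc 1 T,
              (Xmat m T t ω)ᵀ.mulVec (ν m T t ω)) ∂(P m T)) - ∫ x, f x ∂L| < ε))
    -- Assumption 9: E[ν_t | X_t] = 0 and (X_t, ν_t) independent of E_s for all s
    (hCondExp : ∀ m T t, 1 ≤ t → t ≤ T → ∀ i,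
      (P m T)[(fun ω => ν m T t ω i) |
          MeasurableSpace.comap (fun ω => (fun i' c => Xmat m T t ω i' c :
            Fin N → (Fin r ⊕ Fin N ⊕ Fin N) → ℝ)) inferInstance]
        =ᵐ[P m T] fun _ => 0)
    (hIndep : ∀ m T t s, 1 ≤ t → t ≤ T → s ≤ T →
      IndepFun
        (fun ω => ((fun i c => Xmat m T t ω i c : Fin N → (Fin r ⊕ Fin N ⊕ Fin N) → ℝ),
          (fun i => ν m T t ω i : Fin N → ℝ)))
        (fun ω => (fun i j => Err m T s ω i j : Fin m → (Fin N × Fin N) → ℝ))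
        (P m T))
    :
    -- conclusion: with the sign matrix Ĵ_r from Proposition 1,
    -- (i), (ii), (iii) are O_p(1/min(√m,√T))
    ∃ J : ∀ m T : ℕ, Ω m T → Matrix (Fin r) (Fin r) ℝ,
      (∀ m T ω, (J m T ω).IsDiag ∧ ∀ j, J m T ω j j = 1 ∨ J m T ω j j = -1) ∧
      (∀ ε : ℝ, 0 < ε → ∃ C : ℝ, 0 < C ∧ ∃ m₀ T₀ : ℕ, ∀ m T : ℕ,
        m₀ ≤ m → T₀ ≤ T → ∀ t, t ≤ T →
        P m T {ω | C * max (Real.sqrt T)⁻¹ (Real.sqrt m)⁻¹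
            < frobNorm (Fhat m T t ω - J m T ω * F m T t ω)}
          < ENNReal.ofReal ε) ∧
      -- (i)
      (∀ ε : ℝ, 0 < ε → ∃ C : ℝ, 0 < C ∧ ∃ m₀ T₀ : ℕ, ∀ m T : ℕ,
        m₀ ≤ m → T₀ ≤ T →
        P m T {ω | C * (min (Real.sqrt m) (Real.sqrt T))⁻¹
            < frobT ((T : ℝ)⁻¹ • ∑ t ∈ Finset.Icc 1 T,
                mode2 (mode1
                  (fun i j k => Fhat m T (t - 1) ω k (i, j)
                    - ∑ k', J m T ω k k' * F m T (t - 1) ω k' (i, j))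
                  (Xmat m T t ω)ᵀ)
                  (Matrix.of fun (_ : Fin 1) j => y m T (t - 1) ω j))}
          < ENNReal.ofReal ε) ∧
      -- (ii)
      (∀ ε : ℝ, 0 < ε → ∃ C : ℝ, 0 < C ∧ ∃ m₀ T₀ : ℕ, ∀ m T : ℕ,
        m₀ ≤ m → T₀ ≤ T →
        P m T {ω | C * (min (Real.sqrt m) (Real.sqrt T))⁻¹
            < frobT ((T : ℝ)⁻¹ • ∑ t ∈ Finset.Icc 1 T,
                mode2 (mode1
                  (fun i j k => Fhat m T (t - 1) ω k (i, j)
                    - ∑ k', J m T ω k k' * F m T (t - 1) ω k' (i, j))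
                  (Xhat m T t ω)ᵀ)
                  (Matrix.of fun (_ : Fin 1) j => y m T (t - 1) ω j))}
          < ENNReal.ofReal ε) ∧
      -- (iii)
      (∀ ε : ℝ, 0 < ε → ∃ C : ℝ, 0 < C ∧ ∃ m₀ T₀ : ℕ, ∀ m T : ℕ,
        m₀ ≤ m → T₀ ≤ T →
        P m T {ω | C * (min (Real.sqrt m) (Real.sqrt T))⁻¹
            < frobT ((T : ℝ)⁻¹ • ∑ t ∈ Finset.Icc 1 T,
                mode2 (mode1
                  (fun i j k => Fhat m T (t - 1) ω k (i, j)
                    - ∑ k', J m T ω k k' * F m T (t - 1) ω k' (i, j))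
                  (Matrix.of fun (_ : Fin 1) j => ν m T t ω j))
                  (Matrix.of fun (_ : Fin 1) j => y m T (t - 1) ω j))}
          < ENNReal.ofReal ε) := by
  obtain ⟨m₀, hm₀⟩ := hperv
  obtain ⟨γ, κ, hγ, hκ, hspec⟩ := spectral_gap clo cup hclo hsep
  have hl : 0 < max lam 1 := lt_max_of_lt_right one_pos
  generalize hldef : max lam 1 = l at hl
  have hlam' : ∀ m T, ∀ x : Fin m → ℝ, x ⬝ᵥ (ΓE m T).mulVec x ≤ l * (x ⬝ᵥ x) := by
    intro m T x
    refine (hlam m T x).trans (mul_le_mul_of_nonneg_right ?_ (dot_self_nonneg x))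
    rw [← hldef]; exact le_max_left _ _
  have hA7' : ∀ m T t, 1 ≤ t → t ≤ T →
      Integrable (fun ω => (frobNorm (Xmat m T t ω)) ^ 8) (P m T) ∧
      ∫ ω, (frobNorm (Xmat m T t ω)) ^ 8 ∂(P m T) ≤ |Mbd| := fun m T t h1 h2 =>
    ⟨(hA7 m T t h1 h2).1, (hA7 m T t h1 h2).2.trans (le_abs_self _)⟩
  have hspec' : ∀ m T, m₀ ≤ m → _ := fun m T hm => hspec m (μ m T) (hμdec m T) (hm₀ m hm T)
  have hcore := fun m T (h0 : m₀ ≤ m) (hrm : r ≤ m) (hm : 0 < m) (hT : 1 ≤ T) =>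
    core (P := P m T) hm hT (hW m T) (hVorth m T hrm) (hμpos m T) (hμdec m T) (hΓχ m T) (hF m T)
      (hEF m T) hγ hκ (hspec' m T h0).1 (hspec' m T h0).2.1 (hspec' m T h0).2.2 hl (hΓE m T)
      (hlam' m T) (hΓhat m T) (hΓW m T) (hA6 m T hT) (fun ω => hVhatOrth m T ω hrm) (hEigen m T)
      (hμhatDec m T) (hTop m T) (hFhat m T) (hXmat m T) (hA7' m T) (hIndep m T)
  have hK := (Kc_pos r hγ hκ).le
  have hg : 0 < γ ^ 2 / 4 := by positivity
  have hA0 : 0 ≤ 2 * (|R| + l ^ 2) := by positivity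
  have hsize : ∀ c : ℝ, ∃ n₀ : ℕ, ∀ m T : ℕ, n₀ ≤ m → n₀ ≤ T →
      m₀ ≤ m ∧ r ≤ m ∧ 0 < m ∧ 1 ≤ T ∧ 0 < min (m : ℝ) T ∧ 1 ≤ min (m : ℝ) T ∧
        c ≤ min (m : ℝ) T := by
    intro c
    obtain ⟨k, hk⟩ := exists_nat_ge c
    refine ⟨m₀ + r + k + 1, fun m T hm hT => ?_⟩
    have h1 : (1 : ℝ) ≤ m := by exact_mod_cast (show 1 ≤ m by omega)
    have h2 : (1 : ℝ) ≤ T := by exact_mod_cast (show 1 ≤ T by omega)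
    have h3 : (k : ℝ) ≤ m := by exact_mod_cast (show k ≤ m by omega)
    have h4 : (k : ℝ) ≤ T := by exact_mod_cast (show k ≤ T by omega)
    exact ⟨by omega, by omega, by omega, by omega, lt_min (by linarith) (by linarith),
      le_min h1 h2, le_min (hk.trans h3) (hk.trans h4)⟩
  have hgood : ∀ ε : ℝ, 0 < ε → ∃ C : ℝ, 0 < C ∧ ∃ n₀ : ℕ, ∀ m T : ℕ, n₀ ≤ m → n₀ ≤ T →
      1 ≤ min (m : ℝ) T ∧ ∃ Bad : Set (Ω m T), P m T Bad < ENNReal.ofReal ε ∧ ∀ ω, ω ∉ Bad →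
        (T : ℝ)⁻¹ * ∑ t ∈ Finset.Icc 1 T, n2 (Xmat m T t ω) ≤ C ∧
        (T : ℝ)⁻¹ * ∑ t ∈ Finset.Icc 1 T, n2 ((Fhat m T (t - 1) ω -
          Matrix.diagonal (sgnVec (V m T) (Vhat m T ω)) * F m T (t - 1) ω) *
            ymat (y m T (t - 1) ω)) ≤ C * (min (m : ℝ) T)⁻¹ := by
    intro ε hε
    have hB0 : 0 ≤ (1 + |Mbd|) * (1 + l + r * l) := by positivity
    obtain ⟨n₀, hn₀⟩ := hsize (4 * (2 * (|R| + l ^ 2) + 1) / ε / (γ ^ 2 / 4))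
    refine ⟨max (4 * ((1 + |Mbd|) * (1 + l + r * l) + 1) / ε)
      (Kc r γ κ * (4 * (2 * (|R| + l ^ 2) + 1) / ε + 1) *
        (4 * ((1 + |Mbd|) * (1 + l + r * l) + 1) / ε)), lt_max_of_lt_left (by positivity), n₀,
      fun m T hm hT => ?_⟩
    obtain ⟨q1, q2, q3, q4, q5, q6, q7⟩ := hn₀ m T hm hT
    refine ⟨q6, ?_⟩
    obtain ⟨e, Q, Z, he, hQ, hZ, hb1, hb2, hb3⟩ := hcore m T q1 q2 q3 q4
    obtain ⟨Bad, hBad, hgd⟩ := op_bound he hZ hK hg hε hA0 hB0 q5 (min_le_left _ _) hb2 q7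
    refine ⟨Bad, hBad, fun ω hω => ⟨?_, ?_⟩⟩
    · exact (hb3 ω).trans ((hgd ω hω).1.trans (le_max_left _ _))
    · exact (hgd ω hω).2.trans (mul_le_mul_of_nonneg_right (le_max_right _ _)
        (inv_nonneg.2 q5.le))
  refine ⟨fun m T ω => Matrix.diagonal (sgnVec (V m T) (Vhat m T ω)), ?_, ?_, ?_, ?_, ?_⟩
  · intro m T ω
    refine ⟨Matrix.isDiag_diagonal _, fun j => ?_⟩
    have := sgnVec_or (V m T) (Vhat m T ω) j
    simpa only [Matrix.diagonal_apply_eq] using this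
  · intro ε hε
    have hB0 : 0 ≤ (r + l + r * l : ℝ) := by positivity
    obtain ⟨n₀, hn₀⟩ := hsize (4 * (2 * (|R| + l ^ 2) + 1) / ε / (γ ^ 2 / 4))
    have hC0 : 0 < Kc r γ κ * (4 * (2 * (|R| + l ^ 2) + 1) / ε + 1) *
        (4 * ((r + l + r * l : ℝ) + 1) / ε) := by
      have := Kc_pos r hγ hκ
      positivity
    refine ⟨_, Real.sqrt_pos.2 hC0, n₀, n₀, fun m T hm hT t ht => ?_⟩
    obtain ⟨q1, q2, q3, q4, q5, q6, q7⟩ := hn₀ m T hm hT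
    obtain ⟨e, Q, Z, he, hQ, hZ, hb1, hb2, hb3⟩ := hcore m T q1 q2 q3 q4
    obtain ⟨Bad, hBad, hgd⟩ := op_bound he (hQ t ht) hK hg hε hA0 hB0 q5 (min_le_left _ _)
      (hb1 t ht) q7
    refine (measure_mono fun ω hω => ?_).trans_lt hBad
    by_contra hb
    rw [Set.mem_ofPred_eq] at hω
    refine absurd hω (not_lt.2 ?_)
    rw [max_sqrt_inv q3 q4, ← Real.sqrt_mul hC0.le, frobNorm_eq]
    exact Real.sqrt_le_sqrt (hgd ω hb).2
  · intro ε hε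
    obtain ⟨C, hC, n₀, hn₀⟩ := hgood ε hε
    refine ⟨C, hC, n₀, n₀, fun m T hm hT => ?_⟩
    obtain ⟨q, Bad, hBad, hgd⟩ := hn₀ m T hm hT
    refine (measure_mono fun ω hω => ?_).trans_lt hBad
    by_contra hb
    rw [Set.mem_ofPred_eq] at hω
    refine absurd hω (not_lt.2 ?_)
    obtain ⟨g1, g2⟩ := hgd ω hb
    refine (frobT_avg_le (fun t => Fhat m T (t - 1) ω -
      Matrix.diagonal (sgnVec (V m T) (Vhat m T ω)) * F m T (t - 1) ω)
      (fun t => (Xmat m T t ω)ᵀ) (fun t => y m T (t - 1) ω) (A := C)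
      (by simpa only [n2_transpose] using g1) g2).trans (le_of_eq ?_)
    rw [min_sqrt_inv, ← mul_assoc, Real.sqrt_mul (by positivity), Real.sqrt_mul_self hC.le]
  · intro ε hε
    obtain ⟨C, hC, n₀, hn₀⟩ := hgood ε hε
    refine ⟨2 * C, by positivity, n₀, n₀, fun m T hm hT => ?_⟩
    obtain ⟨q, Bad, hBad, hgd⟩ := hn₀ m T hm hT
    refine (measure_mono fun ω hω => ?_).trans_lt hBad
    by_contra hb
    rw [Set.mem_ofPred_eq] at hω
    refine absurd hω (not_lt.2 ?_)
    obtain ⟨g1, g2⟩ := hgd ω hb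
    have g3 : (T : ℝ)⁻¹ * ∑ t ∈ Finset.Icc 1 T, n2 (Xhat m T t ω) ≤ 4 * C := by
      have hle : ∑ t ∈ Finset.Icc 1 T, n2 (Xhat m T t ω) ≤
          2 * ∑ t ∈ Finset.Icc 1 T, n2 (Xmat m T t ω) + 2 * ∑ t ∈ Finset.Icc 1 T,
          n2 ((Fhat m T (t - 1) ω - Matrix.diagonal (sgnVec (V m T) (Vhat m T ω)) *
            F m T (t - 1) ω) * ymat (y m T (t - 1) ω)) := by
        rw [Finset.mul_sum, Finset.mul_sum, ← Finset.sum_add_distrib]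
        exact Finset.sum_le_sum fun t _ => n2_design_hat (F m T (t - 1) ω) (Fhat m T (t - 1) ω)
          (y m T (t - 1) ω) _ (sgnVec_sq _ _) (Xmat m T t ω) (Xhat m T t ω) (hXmat m T t ω)
          (hXhat m T t ω)
      have h1 := mul_le_mul_of_nonneg_left hle (show (0 : ℝ) ≤ (T : ℝ)⁻¹ by positivity)
      have h2 : (min (m : ℝ) T)⁻¹ ≤ 1 := inv_le_one_of_one_le₀ q
      have h3 : C * (min (m : ℝ) T)⁻¹ ≤ C := mul_le_of_le_one_right hC.le h2
      linarith
    refine (frobT_avg_le (fun t => Fhat m T (t - 1) ω -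
      Matrix.diagonal (sgnVec (V m T) (Vhat m T ω)) * F m T (t - 1) ω)
      (fun t => (Xhat m T t ω)ᵀ) (fun t => y m T (t - 1) ω) (A := 4 * C)
      (by simpa only [n2_transpose] using g3) g2).trans (le_of_eq ?_)
    rw [min_sqrt_inv, ← mul_assoc, Real.sqrt_mul (by positivity),
      show 4 * C * C = (2 * C) * (2 * C) by ring, Real.sqrt_mul_self (by positivity)]
  · intro ε hε
    obtain ⟨C, hC, n₀, hn₀⟩ := hgood (ε / 2) (by positivity)
    obtain ⟨m₁, T₁, hpl⟩ := hplim (ε / 2) (by positivity) 1 one_pos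
    set S := ∑ i : Fin N, (|SigXv (Sum.inr (Sum.inr i)) (Sum.inr (Sum.inr i))| + 1) with hS
    have hS0 : 0 ≤ S := Finset.sum_nonneg fun _ _ => by positivity
    have hSC : 0 < (S + 1) * C := by positivity
    refine ⟨_, Real.sqrt_pos.2 hSC, max n₀ m₁, max n₀ T₁, fun m T hm hT => ?_⟩
    obtain ⟨q, Bad, hBad, hgd⟩ := hn₀ m T ((le_max_left _ _).trans hm) ((le_max_left _ _).trans hT)
    have hp := hpl m T ((le_max_right _ _).trans hm) ((le_max_right _ _).trans hT)
    have hun := (measure_union_le (μ := P m T) Bad _).trans_lt (ENNReal.add_lt_add hBad hp)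
    rw [← ENNReal.ofReal_add (by positivity) (by positivity), add_halves] at hun
    refine (measure_mono fun ω hω => ?_).trans_lt hun
    by_contra hb
    rw [Set.mem_ofPred_eq] at hω
    refine absurd hω (not_lt.2 ?_)
    rw [Set.mem_union, not_or, Set.mem_ofPred_eq] at hb
    obtain ⟨g1, g2⟩ := hgd ω hb.1
    have g3 := nu_bound (fun t => Xmat m T t ω) (fun t => ν m T t ω)
      (fun t i i' => by simp only [hXmat]; rfl) SigXv (not_lt.1 hb.2)
    refine (frobT_avg_le (fun t => Fhat m T (t - 1) ω -
      Matrix.diagonal (sgnVec (V m T) (Vhat m T ω)) * F m T (t - 1) ω)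
      (fun t => Matrix.of fun (_ : Fin 1) j => ν m T t ω j) (fun t => y m T (t - 1) ω) (A := S + 1)
      (g3.trans (by linarith)) g2).trans (le_of_eq ?_)
    rw [min_sqrt_inv, ← mul_assoc, Real.sqrt_mul (by positivity)]
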